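/- Let C > 0, β > 0, b > 0 and d > 0. Let Ω ⊂ ℝ² be a normalized convex domain and f ∈ 𝒮(Ω,C) satisfy PDE (1.2) with parameter β; let u be the Legendre transform function of f relative to 0, assume d + u > 0 on Ω and 1/(ρ(d+u)) < b on Ω. Then there are positive constants α, N and m such that 𝒜 ≤ max{d₁, (4/(αβ))·𝒟}, where d₁ is a constant depending only on α, C, b, β and d. -/

import Mathlib

open Real Filter Topology Matrix

noncomputable section

/-- The `i`-th partial derivative of `f`. -/
def pd {n : ℕ} (i : Fin n) (f : (Fin n → ℝ) → ℝ) : (Fin n → ℝ) → ℝ :=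
  fun x => fderiv ℝ f x (Pi.single i 1)

/-- The Hessian matrix `(∂²f/∂x_i∂x_j)` of `f` at `x`. -/
def hess {n : ℕ} (f : (Fin n → ℝ) → ℝ) (x : Fin n → ℝ) : Matrix (Fin n) (Fin n) ℝ :=
  Matrix.of fun i j => pd i (pd j f) x

/-- The gradient vector of `f` at `x`. -/
def gradv {n : ℕ} (f : (Fin n → ℝ) → ℝ) (x : Fin n → ℝ) : Fin n → ℝ :=
  fun i => pd i f x

/-- `ρ := (det (f_ij))^(-1/(n+2))`. -/
def rho {n : ℕ} (f : (Fin n → ℝ) → ℝ) (x : Fin n → ℝ) : ℝ :=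
  (hess f x).det ^ (-(1 : ℝ) / ((n : ℝ) + 2))

/-- The squared norm `‖grad h‖² = ∑ f^{ij} h_i h_j` with respect to the Calabi metric of `f`. -/
def gradSq {n : ℕ} (f h : (Fin n → ℝ) → ℝ) (x : Fin n → ℝ) : ℝ :=
  ∑ i, ∑ j, (hess f x)⁻¹ i j * pd i h x * pd j h x

/-- The Laplacian `Δh = (1/√det)(∑ ∂_i(√det · f^{ij} ∂_j h))` with respect to the
Calabi metric of `f`. -/
def calabiLap {n : ℕ} (f h : (Fin n → ℝ) → ℝ) (x : Fin n → ℝ) : ℝ :=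
  (Real.sqrt (hess f x).det)⁻¹ *
    ∑ i, ∑ j, pd i (fun y => Real.sqrt (hess f y).det * (hess f y)⁻¹ i j * pd j h y) x

/-- `Φ := ‖grad ρ‖²/ρ²`. -/
def Phi {n : ℕ} (f : (Fin n → ℝ) → ℝ) (x : Fin n → ℝ) : ℝ :=
  gradSq f (rho f) x / (rho f x) ^ 2

/-- PDE (1.2): `Δρ = -β ‖grad ρ‖²/ρ` on `Ω`. -/
def PDE2 {n : ℕ} (f : (Fin n → ℝ) → ℝ) (β : ℝ) (Ω : Set (Fin n → ℝ)) : Prop :=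
  ∀ x ∈ Ω, calabiLap f (rho f) x = -β * gradSq f (rho f) x / rho f x

/-- The cofactor matrix of a square matrix. -/
def cof {n : ℕ} (H : Matrix (Fin n) (Fin n) ℝ) : Matrix (Fin n) (Fin n) ℝ :=
  (Matrix.adjugate H)ᵀ

/-- PDE (1.1): `∑ F^{ij} w_ij = 0` with `w = (det (f_ij))^a` on `Ω`, where `(F^{ij})`
is the cofactor matrix of the Hessian of `f`. -/
def PDE1 {n : ℕ} (f : (Fin n → ℝ) → ℝ) (a : ℝ) (Ω : Set (Fin n → ℝ)) : Prop :=
  ∀ x ∈ Ω, ∑ i, ∑ j,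
    cof (hess f x) i j * pd i (pd j fun y => (hess f y).det ^ a) x = 0

/-- `f` is a quadratic polynomial on `ℝ²`. -/
def IsQuadratic (f : (Fin 2 → ℝ) → ℝ) : Prop :=
  ∃ (Q : Matrix (Fin 2) (Fin 2) ℝ) (b : Fin 2 → ℝ) (c : ℝ),
    ∀ x, f x = (∑ i, ∑ j, Q i j * x i * x j) + (∑ i, b i * x i) + c

/-- Euclidean open ball of radius `r` centered at `0` in `ℝ²`. -/
def ebal (r : ℝ) : Set (Fin 2 → ℝ) := {x | (x 0) ^ 2 + (x 1) ^ 2 < r ^ 2}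

/-- Euclidean norm on `ℝ²`. -/
def enorm2 (x : Fin 2 → ℝ) : ℝ := Real.sqrt ((x 0) ^ 2 + (x 1) ^ 2)

/-- A normalized convex domain: `B_{2^{-3/2}}(0) ⊆ Ω ⊆ B_1(0)`. -/
def NormalizedDomain (Ω : Set (Fin 2 → ℝ)) : Prop :=
  IsOpen Ω ∧ Convex ℝ Ω ∧ ebal ((2 : ℝ) ^ (-(3 : ℝ) / 2)) ⊆ Ω ∧ Ω ⊆ ebal 1

/-- The class `𝒮(Ω,C)`: smooth strictly convex functions on `Ω` with `inf f = 0` and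
`f = C` on `∂Ω`. -/
def SClass (Ω : Set (Fin 2 → ℝ)) (C : ℝ) (f : (Fin 2 → ℝ) → ℝ) : Prop :=
  ContDiffOn ℝ (⊤ : ℕ∞) f Ω ∧ (∀ x ∈ Ω, (hess f x).PosDef) ∧
    sInf (f '' Ω) = 0 ∧ ContinuousOn f (closure Ω) ∧ ∀ x ∈ frontier Ω, f x = C

/-- `u` is the Legendre transform function of `f` relative to `0`:
`u(∇f(x)) = ⟨x, ∇f(x)⟩ - f(x)`. -/
def LegendreOf (Ω : Set (Fin 2 → ℝ)) (f u : (Fin 2 → ℝ) → ℝ) : Prop :=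
  ∀ x ∈ Ω, u (gradv f x) = (∑ i, x i * gradv f x i) - f x

end

/-- `𝒜 = max_Ω exp{-m/(C-f)} Φ / (ρ^α (d+u)^α)`. -/
noncomputable def Aval (Ω : Set (Fin 2 → ℝ)) (C m α d : ℝ) (f u : (Fin 2 → ℝ) → ℝ) : ℝ :=
  sSup ((fun x => Real.exp (-m / (C - f x)) * Phi f x /
    ((rho f x) ^ α * (d + u (gradv f x)) ^ α)) '' Ω)

/-- `K = (N/𝒜) exp{-m/(C-f)} Φ / (ρ^α (d+u)^α)`. -/
noncomputable def Kfun (Ω : Set (Fin 2 → ℝ)) (C m α N d : ℝ) (f u : (Fin 2 → ℝ) → ℝ)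
    (x : Fin 2 → ℝ) : ℝ :=
  N / Aval Ω C m α d f u *
    (Real.exp (-m / (C - f x)) * Phi f x / ((rho f x) ^ α * (d + u (gradv f x)) ^ α))

/-- `𝒟 = max_Ω exp{-m/(C-f)+K} g² ‖grad f‖² / (ρ^α (d+u)^α)` with `g = m/(C-f)²`. -/
noncomputable def Dval (Ω : Set (Fin 2 → ℝ)) (C m α N d : ℝ) (f u : (Fin 2 → ℝ) → ℝ) : ℝ :=
  sSup ((fun x => Real.exp (-m / (C - f x) + Kfun Ω C m α N d f u x) *
    (m / (C - f x) ^ 2) ^ 2 * gradSq f f x /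
    ((rho f x) ^ α * (d + u (gradv f x)) ^ α)) '' Ω)

/-- The derivative of `h` in the direction `v`. -/
noncomputable def dirD (v : Fin 2 → ℝ) (h : (Fin 2 → ℝ) → ℝ) : (Fin 2 → ℝ) → ℝ :=
  fun x => fderiv ℝ h x v

lemma pd_eq_dirD (i : Fin 2) (h : (Fin 2 → ℝ) → ℝ) : pd i h = dirD (Pi.single i 1) h := rfl

lemma dirD_contDiffOn {Ω : Set (Fin 2 → ℝ)} (hΩ : IsOpen Ω) {h : (Fin 2 → ℝ) → ℝ}
    (hh : ContDiffOn ℝ (⊤ : ℕ∞) h Ω) (v : Fin 2 → ℝ) :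
    ContDiffOn ℝ (⊤ : ℕ∞) (dirD v h) Ω :=
  (hh.fderiv_of_isOpen hΩ (m := ((⊤ : ℕ∞) : WithTop ℕ∞)) (by simp)).clm_apply contDiffOn_const

lemma differentiableAt_of_contDiffOn {Ω : Set (Fin 2 → ℝ)} (hΩ : IsOpen Ω)
    {h : (Fin 2 → ℝ) → ℝ} (hh : ContDiffOn ℝ (⊤ : ℕ∞) h Ω) {x : Fin 2 → ℝ} (hx : x ∈ Ω) :
    DifferentiableAt ℝ h x :=
  (hh.contDiffAt (hΩ.mem_nhds hx)).differentiableAt (by simp)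

lemma dirD_comm {Ω : Set (Fin 2 → ℝ)} (hΩ : IsOpen Ω) {h : (Fin 2 → ℝ) → ℝ}
    (hh : ContDiffOn ℝ (⊤ : ℕ∞) h Ω) (v w : Fin 2 → ℝ) {x : Fin 2 → ℝ} (hx : x ∈ Ω) :
    dirD v (dirD w h) x = dirD w (dirD v h) x := by
  have hc := hh.contDiffAt (hΩ.mem_nhds hx)
  have hs : IsSymmSndFDerivAt ℝ h x := hc.isSymmSndFDerivAt (by
    simpa using (by exact_mod_cast le_top : ((2 : ℕ∞) : WithTop ℕ∞) ≤ ((⊤ : ℕ∞) : WithTop ℕ∞)))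
  have hd : DifferentiableAt ℝ (fderiv ℝ h) x :=
    (hc.fderiv_right (m := 1) (by norm_cast)).differentiableAt (by simp)
  unfold dirD
  rw [fderiv_clm_apply hd (by fun_prop), fderiv_clm_apply hd (by fun_prop)]
  simpa using hs v w

lemma dirD_congr {Ω : Set (Fin 2 → ℝ)} (hΩ : IsOpen Ω) {h k : (Fin 2 → ℝ) → ℝ}
    (hk : ∀ x ∈ Ω, h x = k x) (v : Fin 2 → ℝ) {x : Fin 2 → ℝ} (hx : x ∈ Ω) :
    dirD v h x = dirD v k x := by
  unfold dirD
  rw [Filter.EventuallyEq.fderiv_eq]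
  filter_upwards [hΩ.mem_nhds hx] with y hy using hk y hy

lemma dirD_comb (v w : Fin 2 → ℝ) (a b : ℝ) (h : (Fin 2 → ℝ) → ℝ) (x : Fin 2 → ℝ) :
    dirD (a • v + b • w) h x = a * dirD v h x + b * dirD w h x := by
  simp [dirD]

lemma dirD_eq_coord (v : Fin 2 → ℝ) (h : (Fin 2 → ℝ) → ℝ) (x : Fin 2 → ℝ) :
    dirD v h x = v 0 * pd 0 h x + v 1 * pd 1 h x := by
  rw [pd_eq_dirD, pd_eq_dirD, ← dirD_comb]
  congr 1
  ext i; fin_cases i <;> simp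

lemma hasDerivAt_line {h : (Fin 2 → ℝ) → ℝ} {x v : Fin 2 → ℝ} {t : ℝ}
    (hd : DifferentiableAt ℝ h (x + t • v)) :
    HasDerivAt (fun t : ℝ => h (x + t • v)) (dirD v h (x + t • v)) t := by
  have h1 : HasDerivAt (fun t : ℝ => x + t • v) v t := by
    simpa using ((hasDerivAt_id t).smul_const v).const_add x
  exact hd.hasFDerivAt.comp_hasDerivAt t h1

lemma hasDerivAt_line_zero {Ω : Set (Fin 2 → ℝ)} (hΩ : IsOpen Ω) {h : (Fin 2 → ℝ) → ℝ}
    (hh : ContDiffOn ℝ (⊤ : ℕ∞) h Ω) {x : Fin 2 → ℝ} (hx : x ∈ Ω) (v : Fin 2 → ℝ) :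
    HasDerivAt (fun t : ℝ => h (x + t • v)) (dirD v h x) 0 := by
  have := hasDerivAt_line (h := h) (x := x) (v := v) (t := 0)
    (by simpa using differentiableAt_of_contDiffOn hΩ hh hx)
  simpa using this

/-- `φ` is twice differentiable at `0`, with first derivative `a` and second derivative `b`. -/
def TwoJet (φ : ℝ → ℝ) (a b : ℝ) : Prop :=
  ∃ φ₁ : ℝ → ℝ, (∀ᶠ t in 𝓝 0, HasDerivAt φ (φ₁ t) t) ∧ φ₁ 0 = a ∧ HasDerivAt φ₁ b 0

namespace TwoJet

variable {φ ψ : ℝ → ℝ} {a b c d : ℝ}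

lemma hasDerivAt (h : TwoJet φ a b) : HasDerivAt φ a 0 := by
  obtain ⟨φ₁, h1, rfl, -⟩ := h
  exact h1.self_of_nhds

lemma unique (h : TwoJet φ a b) (h' : TwoJet φ c d) : a = c ∧ b = d := by
  refine ⟨h.hasDerivAt.unique h'.hasDerivAt, ?_⟩
  obtain ⟨φ₁, h1, -, h2⟩ := h
  obtain ⟨φ₂, h3, -, h4⟩ := h'
  refine h2.unique (h4.congr_of_eventuallyEq ?_)
  filter_upwards [h1, h3] with t ht ht' using ht.unique ht'

lemma congr (h : TwoJet φ a b) (e : φ =ᶠ[𝓝 0] ψ) : TwoJet ψ a b := by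
  obtain ⟨φ₁, h1, h2, h3⟩ := h
  refine ⟨φ₁, ?_, h2, h3⟩
  filter_upwards [h1, e.eventually_nhds] with t ht he
  exact ht.congr_of_eventuallyEq (he.mono fun _ h => h.symm)

lemma add (h : TwoJet φ a b) (h' : TwoJet ψ c d) :
    TwoJet (fun t => φ t + ψ t) (a + c) (b + d) := by
  obtain ⟨φ₁, h1, rfl, h2⟩ := h
  obtain ⟨φ₂, h3, rfl, h4⟩ := h'
  refine ⟨fun t => φ₁ t + φ₂ t, ?_, rfl, h2.add h4⟩
  filter_upwards [h1, h3] with t ht ht' using ht.add ht'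

lemma const_mul (k : ℝ) (h : TwoJet φ a b) : TwoJet (fun t => k * φ t) (k * a) (k * b) := by
  obtain ⟨φ₁, h1, rfl, h2⟩ := h
  refine ⟨fun t => k * φ₁ t, ?_, rfl, h2.const_mul k⟩
  filter_upwards [h1] with t ht using ht.const_mul k

lemma const_add (k : ℝ) (h : TwoJet φ a b) : TwoJet (fun t => k + φ t) a b := by
  obtain ⟨φ₁, h1, rfl, h2⟩ := h
  refine ⟨φ₁, ?_, rfl, h2⟩
  filter_upwards [h1] with t ht using ht.const_add k

lemma sub (h : TwoJet φ a b) (h' : TwoJet ψ c d) :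
    TwoJet (fun t => φ t - ψ t) (a - c) (b - d) := by
  convert h.add (h'.const_mul (-1)) using 1
  · ext t; ring
  · ring
  · ring

lemma mul (h : TwoJet φ a b) (h' : TwoJet ψ c d) :
    TwoJet (fun t => φ t * ψ t) (a * ψ 0 + φ 0 * c) (b * ψ 0 + 2 * a * c + φ 0 * d) := by
  obtain ⟨φ₁, h1, rfl, h2⟩ := h
  obtain ⟨φ₂, h3, rfl, h4⟩ := h'
  refine ⟨fun t => φ₁ t * ψ t + φ t * φ₂ t, ?_, rfl, ?_⟩
  · filter_upwards [h1, h3] with t ht ht' using ht.mul ht'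
  · refine ((h2.mul h3.self_of_nhds).add (h1.self_of_nhds.mul h4)).congr_deriv ?_
    ring

lemma comp {χ χ₁ : ℝ → ℝ} {e : ℝ} (h : TwoJet φ a b)
    (h1 : ∀ᶠ y in 𝓝 (φ 0), HasDerivAt χ (χ₁ y) y) (h2 : HasDerivAt χ₁ e (φ 0)) :
    TwoJet (fun t => χ (φ t)) (χ₁ (φ 0) * a) (e * a ^ 2 + χ₁ (φ 0) * b) := by
  have hc := h.hasDerivAt.continuousAt
  obtain ⟨φ₁, h3, rfl, h4⟩ := h
  refine ⟨fun t => χ₁ (φ t) * φ₁ t, ?_, rfl, ?_⟩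
  · filter_upwards [h3, hc.eventually h1] with t ht ht' using ht'.comp t ht
  · refine ((h2.comp 0 h3.self_of_nhds).mul h4).congr_deriv ?_
    simp only [Function.comp_apply]
    ring

lemma exp (h : TwoJet φ a b) :
    TwoJet (fun t => Real.exp (φ t)) (Real.exp (φ 0) * a)
      (Real.exp (φ 0) * a ^ 2 + Real.exp (φ 0) * b) :=
  h.comp (Eventually.of_forall Real.hasDerivAt_exp) (Real.hasDerivAt_exp _)

lemma log (h : TwoJet φ a b) (h0 : 0 < φ 0) :
    TwoJet (fun t => Real.log (φ t)) (a / φ 0) (b / φ 0 - (a / φ 0) ^ 2) := by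
  have h1 : ∀ᶠ y in 𝓝 (φ 0), HasDerivAt Real.log (y⁻¹) y := by
    filter_upwards [lt_mem_nhds h0] with y hy using Real.hasDerivAt_log hy.ne'
  convert h.comp h1 (hasDerivAt_inv h0.ne') using 1
  · field_simp
  · field_simp; ring

lemma inv (h : TwoJet φ a b) (h0 : 0 < φ 0) :
    TwoJet (fun t => (φ t)⁻¹) (-a / φ 0 ^ 2) (2 * a ^ 2 / φ 0 ^ 3 - b / φ 0 ^ 2) := by
  have h1 : ∀ᶠ y in 𝓝 (φ 0), HasDerivAt (fun y : ℝ => y⁻¹) (-(y⁻¹ * y⁻¹)) y := by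
    filter_upwards [lt_mem_nhds h0] with y hy
    refine (hasDerivAt_inv hy.ne').congr_deriv ?_
    field_simp
  have h2 := hasDerivAt_inv h0.ne'
  convert h.comp h1 (h2.mul h2).neg using 1
  · field_simp
  · field_simp; ring

lemma of_isLocalMax (h : TwoJet φ a b) (hm : IsLocalMax φ 0) : a = 0 ∧ b ≤ 0 := by
  have ha : a = 0 := hm.hasDerivAt_eq_zero h.hasDerivAt
  refine ⟨ha, ?_⟩
  by_contra! hb
  obtain ⟨φ₁, h1, h2, h3⟩ := h
  have e : deriv φ =ᶠ[𝓝 0] φ₁ := by filter_upwards [h1] with t ht using ht.deriv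
  have hmin : IsLocalMin φ 0 := isLocalMin_of_deriv_deriv_pos
    (by rw [e.deriv_eq, h3.deriv]; exact hb) (by rw [h1.self_of_nhds.deriv, h2, ha])
    h1.self_of_nhds.continuousAt
  have hc : φ =ᶠ[𝓝 0] fun _ => φ 0 := by
    filter_upwards [hm, hmin] with t ht ht' using le_antisymm ht ht'
  have hz : φ₁ =ᶠ[𝓝 0] fun _ => 0 := by
    filter_upwards [h1, hc.eventually_nhds] with t ht hct
    exact ht.unique ((hasDerivAt_const t (φ 0)).congr_of_eventuallyEq hct)
  have := h3.unique ((hasDerivAt_const (0 : ℝ) (0 : ℝ)).congr_of_eventuallyEq hz)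
  linarith

lemma of_contDiffOn {Ω : Set (Fin 2 → ℝ)} (hΩ : IsOpen Ω) {h : (Fin 2 → ℝ) → ℝ}
    (hh : ContDiffOn ℝ (⊤ : ℕ∞) h Ω) {x : Fin 2 → ℝ} (hx : x ∈ Ω) (v : Fin 2 → ℝ) :
    TwoJet (fun t => h (x + t • v)) (dirD v h x) (dirD v (dirD v h) x) := by
  refine ⟨fun t => dirD v h (x + t • v), ?_, by simp,
    hasDerivAt_line_zero hΩ (dirD_contDiffOn hΩ hh v) hx v⟩
  have hc : ContinuousAt (fun t : ℝ => x + t • v) 0 := by fun_prop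
  have hm : Ω ∈ 𝓝 (x + (0 : ℝ) • v) := by simpa using hΩ.mem_nhds hx
  filter_upwards [hc.preimage_mem_nhds hm] with t ht
  exact hasDerivAt_line (differentiableAt_of_contDiffOn hΩ hh ht)

end TwoJet

lemma eventually_line {Ω : Set (Fin 2 → ℝ)} (hΩ : IsOpen Ω) {x : Fin 2 → ℝ} (hx : x ∈ Ω)
    (v : Fin 2 → ℝ) : ∀ᶠ t : ℝ in 𝓝 0, x + t • v ∈ Ω := by
  have hc : ContinuousAt (fun t : ℝ => x + t • v) 0 := by fun_prop
  exact hc.preimage_mem_nhds (by simpa using hΩ.mem_nhds hx)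


lemma dirD_dirD_coord {Ω : Set (Fin 2 → ℝ)} (hΩ : IsOpen Ω) {h : (Fin 2 → ℝ) → ℝ}
    (hh : ContDiffOn ℝ (⊤ : ℕ∞) h Ω) (v w : Fin 2 → ℝ) {x : Fin 2 → ℝ} (hx : x ∈ Ω) :
    dirD v (dirD w h) x = v 0 * w 0 * hess h x 0 0 + (v 0 * w 1 + v 1 * w 0) * hess h x 0 1 +
      v 1 * w 1 * hess h x 1 1 := by
  have hc : ∀ i, pd i (dirD w h) x = dirD w (pd i h) x := fun i => dirD_comm hΩ hh _ _ hx
  have h01 : pd 0 (pd 1 h) x = pd 1 (pd 0 h) x := dirD_comm hΩ hh _ _ hx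
  rw [dirD_eq_coord, hc, hc, dirD_eq_coord, dirD_eq_coord]
  simp only [hess, Matrix.of_apply]
  rw [h01]
  ring

lemma hess_symm {Ω : Set (Fin 2 → ℝ)} (hΩ : IsOpen Ω) {h : (Fin 2 → ℝ) → ℝ}
    (hh : ContDiffOn ℝ (⊤ : ℕ∞) h Ω) {x : Fin 2 → ℝ} (hx : x ∈ Ω) :
    hess h x 1 0 = hess h x 0 1 :=
  dirD_comm hΩ hh _ _ hx

section Convexity

variable {Ω : Set (Fin 2 → ℝ)} {C : ℝ} {f u : (Fin 2 → ℝ) → ℝ}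

lemma dirD_dirD_pos (hΩ : IsOpen Ω) (hf : ContDiffOn ℝ (⊤ : ℕ∞) f Ω)
    (hp : ∀ x ∈ Ω, (hess f x).PosDef) {x v : Fin 2 → ℝ} (hx : x ∈ Ω) (hv : v ≠ 0) :
    0 < dirD v (dirD v f) x := by
  have h := (hp x hx).dotProduct_mulVec_pos hv
  rw [dirD_dirD_coord hΩ hf v v hx]
  simp [Matrix.mulVec, dotProduct, Fin.sum_univ_two, hess_symm hΩ hf hx] at h
  linarith

lemma tangent_le (hΩ : IsOpen Ω) (hconv : Convex ℝ Ω) (hf : ContDiffOn ℝ (⊤ : ℕ∞) f Ω)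
    (hp : ∀ x ∈ Ω, (hess f x).PosDef) {x y : Fin 2 → ℝ} (hx : x ∈ Ω) (hy : y ∈ Ω) :
    f x + dirD (y - x) f x ≤ f y := by
  rcases eq_or_ne y x with rfl | hne
  · simp [dirD]
  set v := y - x with hv
  have hv0 : v ≠ 0 := sub_ne_zero.2 hne
  have hmem : ∀ t ∈ Set.Icc (0 : ℝ) 1, x + t • v ∈ Ω := fun t ht => by
    have := hconv hx hy (sub_nonneg.2 ht.2) ht.1 (by ring)
    convert this using 1
    rw [hv]; module
  have hd1 : ∀ t ∈ Set.Icc (0 : ℝ) 1, HasDerivAt (fun t : ℝ => f (x + t • v))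
      (dirD v f (x + t • v)) t := fun t ht =>
    hasDerivAt_line (differentiableAt_of_contDiffOn hΩ hf (hmem t ht))
  have hd2 : ∀ t ∈ Set.Icc (0 : ℝ) 1, HasDerivAt (fun t : ℝ => dirD v f (x + t • v))
      (dirD v (dirD v f) (x + t • v)) t := fun t ht =>
    hasDerivAt_line (differentiableAt_of_contDiffOn hΩ (dirD_contDiffOn hΩ hf v) (hmem t ht))
  obtain ⟨c, hc, hc'⟩ := exists_hasDerivAt_eq_slope (fun t : ℝ => f (x + t • v))
    (fun t => dirD v f (x + t • v)) one_pos
    (fun t ht => (hd1 t ht).continuousAt.continuousWithinAt)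
    (fun t ht => hd1 t ⟨ht.1.le, ht.2.le⟩)
  have hsub : ∀ t ∈ Set.Icc 0 c, t ∈ Set.Icc (0 : ℝ) 1 := fun t ht => ⟨ht.1, ht.2.trans hc.2.le⟩
  obtain ⟨e, he, he'⟩ := exists_hasDerivAt_eq_slope (fun t : ℝ => dirD v f (x + t • v))
    (fun t => dirD v (dirD v f) (x + t • v)) hc.1
    (fun t ht => (hd2 t (hsub t ht)).continuousAt.continuousWithinAt)
    (fun t ht => hd2 t (hsub t ⟨ht.1.le, ht.2.le⟩))
  have hpos := dirD_dirD_pos hΩ hf hp (hmem e (hsub e ⟨he.1.le, he.2.le⟩)) hv0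
  rw [he', lt_div_iff₀ (by linarith [hc.1])] at hpos
  have hxy : x + (1 : ℝ) • v = y := by rw [hv]; module
  simp only [zero_smul, add_zero, hxy, sub_zero, div_one] at hc' hpos
  linarith

lemma cube_subset (hN : NormalizedDomain Ω) {x : Fin 2 → ℝ} (hx : x 0 ^ 2 + x 1 ^ 2 ≤ 2 / 25) :
    x ∈ Ω := by
  refine hN.2.2.1 ?_
  have : ((2 : ℝ) ^ (-(3 : ℝ) / 2)) ^ 2 = 1 / 8 := by
    rw [← Real.rpow_natCast, ← Real.rpow_mul (by norm_num)]
    norm_num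
  simp only [ebal, Set.mem_ofPred_eq, this]
  linarith

lemma abs_coord_le_of_mem_closure (hN : NormalizedDomain Ω) {x : Fin 2 → ℝ}
    (hx : x ∈ closure Ω) (i : Fin 2) : |x i| ≤ 1 := by
  have hcl : IsClosed {x : Fin 2 → ℝ | |x i| ≤ 1} :=
    isClosed_le (by fun_prop) continuous_const
  refine hcl.closure_subset_iff.2 (fun y hy => ?_) hx
  have := hN.2.2.2 hy
  simp only [ebal, Set.mem_ofPred_eq] at this ⊢
  rw [abs_le_one_iff_mul_self_le_one]
  fin_cases i <;> simp <;> nlinarith [sq_nonneg (y 0), sq_nonneg (y 1)]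

lemma isCompact_closure (hN : NormalizedDomain Ω) : IsCompact (closure Ω) := by
  refine Metric.isCompact_of_isClosed_isBounded isClosed_closure ?_
  refine (Metric.isBounded_closedBall (x := (0 : Fin 2 → ℝ)) (r := 1)).subset fun x hx => ?_
  rw [mem_closedBall_zero_iff, pi_norm_le_iff_of_nonneg zero_le_one]
  exact fun i => abs_coord_le_of_mem_closure hN hx i

lemma NormalizedDomain.zero_mem (hN : NormalizedDomain Ω) : (0 : Fin 2 → ℝ) ∈ Ω := cube_subset hN (by norm_num)

lemma not_isLocalMax (hΩ : IsOpen Ω) (hf : ContDiffOn ℝ (⊤ : ℕ∞) f Ω)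
    (hp : ∀ x ∈ Ω, (hess f x).PosDef) {x : Fin 2 → ℝ} (hx : x ∈ Ω) : ¬ IsLocalMax f x := by
  intro hm
  have hv : (Pi.single 0 1 : Fin 2 → ℝ) ≠ 0 := by simp
  have h1 := dirD_dirD_pos hΩ hf hp hx hv
  have hc : ContinuousAt (fun t : ℝ => x + t • (Pi.single 0 1 : Fin 2 → ℝ)) 0 := by fun_prop
  have hm' : IsLocalMax (fun t : ℝ => f (x + t • (Pi.single 0 1 : Fin 2 → ℝ))) 0 := by
    have : Tendsto (fun t : ℝ => x + t • (Pi.single 0 1 : Fin 2 → ℝ)) (𝓝 0) (𝓝 x) := by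
      simpa using hc.tendsto
    filter_upwards [this.eventually hm] with t ht
    simpa using ht
  linarith [((TwoJet.of_contDiffOn hΩ hf hx (Pi.single 0 1)).of_isLocalMax hm').2]

lemma lt_of_SClass (hN : NormalizedDomain Ω) (hS : SClass Ω C f) {x : Fin 2 → ℝ} (hx : x ∈ Ω) :
    f x < C := by
  obtain ⟨hf, hp, -, hcont, hbd⟩ := hS
  obtain ⟨z, hz, hmax⟩ := (isCompact_closure hN).exists_isMaxOn
    ⟨x, subset_closure hx⟩ hcont
  have key : ∀ y ∈ Ω, ¬ ∀ w ∈ Ω, f w ≤ f y := fun y hy h =>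
    not_isLocalMax hN.1 hf hp hy (by filter_upwards [hN.1.mem_nhds hy] with w hw using h w hw)
  have hzf : f z = C := by
    by_cases hzΩ : z ∈ Ω
    · exact absurd (fun w hw => hmax (subset_closure hw)) (key z hzΩ)
    · exact hbd z ⟨hz, by rwa [hN.1.interior_eq]⟩
  have hle : ∀ w ∈ Ω, f w ≤ C := fun w hw => hzf ▸ hmax (subset_closure hw)
  refine lt_of_le_of_ne (hle x hx) fun h => key x hx fun w hw => h ▸ hle w hw

lemma nonneg_of_SClass (hN : NormalizedDomain Ω) (hS : SClass Ω C f) {x : Fin 2 → ℝ}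
    (hx : x ∈ Ω) : 0 ≤ f x := by
  obtain ⟨hf, hp, hinf, hcont, hbd⟩ := hS
  have hb : BddBelow (f '' Ω) :=
    ((isCompact_closure hN).bddBelow_image hcont).mono (Set.image_mono subset_closure)
  rw [← hinf]
  exact csInf_le hb ⟨x, hx, rfl⟩

lemma zero_le_of_SClass (hN : NormalizedDomain Ω) (hS : SClass Ω C f) : f 0 ≤ 5 * C / 6 := by
  have h0 := hN.zero_mem
  refine le_of_forall_pos_le_add fun ε hε => ?_
  have hne : (f '' Ω).Nonempty := ⟨_, 0, h0, rfl⟩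
  obtain ⟨_, ⟨x, hx, rfl⟩, hlt⟩ := exists_lt_of_csInf_lt hne (hS.2.2.1 ▸ hε : sInf (f '' Ω) < ε)
  have hx' : (-(1 / 5 : ℝ)) • x ∈ Ω := by
    refine cube_subset hN ?_
    have := hN.2.2.2 hx
    simp only [ebal, Set.mem_ofPred_eq] at this
    simp only [Pi.smul_apply, smul_eq_mul]
    nlinarith
  have h1 := tangent_le hN.1 hN.2.1 hS.1 hS.2.1 h0 hx
  have h2 := tangent_le hN.1 hN.2.1 hS.1 hS.2.1 h0 hx'
  have h3 := lt_of_SClass hN hS hx'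
  simp only [sub_zero, dirD, map_smul, smul_eq_mul] at h1 h2
  linarith

lemma boundary_le (hN : NormalizedDomain Ω) (hS : SClass Ω C f) {y : Fin 2 → ℝ}
    (hy : y ∈ closure Ω) : f 0 + dirD y f 0 ≤ f y := by
  refine ContinuousWithinAt.closure_le (s := Ω) (f := fun y => f 0 + dirD y f 0) hy ?_
    ((hS.2.2.2.1 y hy).mono subset_closure) fun x hx => ?_
  · unfold dirD; fun_prop
  · simpa using tangent_le hN.1 hN.2.1 hS.1 hS.2.1 (hN.zero_mem) hx

lemma abs_gradv_zero_le (hN : NormalizedDomain Ω) (hS : SClass Ω C f) :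
    |gradv f 0 0| + |gradv f 0 1| ≤ 5 * C := by
  have h0 := nonneg_of_SClass hN hS (hN.zero_mem)
  have key : ∀ a b : ℝ, a ^ 2 = 1 → b ^ 2 = 1 → a * gradv f 0 0 + b * gradv f 0 1 ≤ 5 * C := by
    intro a b ha hb
    have hm : ![a / 5, b / 5] ∈ Ω := cube_subset hN (by simp; nlinarith)
    have h1 := boundary_le hN hS (subset_closure hm)
    have h2 := lt_of_SClass hN hS hm
    rw [dirD_eq_coord] at h1
    simp at h1
    simp only [gradv]
    linarith
  rcases abs_cases (gradv f 0 0) with ⟨h, -⟩ | ⟨h, -⟩ <;>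
    rcases abs_cases (gradv f 0 1) with ⟨h', -⟩ | ⟨h', -⟩ <;> rw [h, h']
  · simpa using key 1 1 (by norm_num) (by norm_num)
  · simpa [sub_eq_add_neg] using key 1 (-1) (by norm_num) (by norm_num)
  · simpa using key (-1) 1 (by norm_num) (by norm_num)
  · simpa using key (-1) (-1) (by norm_num) (by norm_num)

end Convexity

/-- The value of the Legendre transform of `f` at the gradient of `f` at `x`. -/
noncomputable def legVal (f : (Fin 2 → ℝ) → ℝ) (x : Fin 2 → ℝ) : ℝ :=
  x 0 * pd 0 f x + x 1 * pd 1 f x - f x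

lemma LegendreOf.eq_legVal {Ω : Set (Fin 2 → ℝ)} {f u : (Fin 2 → ℝ) → ℝ}
    (h : LegendreOf Ω f u) {x : Fin 2 → ℝ} (hx : x ∈ Ω) : u (gradv f x) = legVal f x := by
  rw [h x hx, Fin.sum_univ_two]
  rfl

lemma legVal_zero (f : (Fin 2 → ℝ) → ℝ) : legVal f 0 = -f 0 := by simp [legVal]

lemma contDiffOn_coord {Ω : Set (Fin 2 → ℝ)} (i : Fin 2) :
    ContDiffOn ℝ (⊤ : ℕ∞) (fun x : Fin 2 → ℝ => x i) Ω :=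
  (contDiff_apply ℝ ℝ i).contDiffOn

lemma pd_contDiffOn {Ω : Set (Fin 2 → ℝ)} (hΩ : IsOpen Ω) {h : (Fin 2 → ℝ) → ℝ}
    (hh : ContDiffOn ℝ (⊤ : ℕ∞) h Ω) (i : Fin 2) : ContDiffOn ℝ (⊤ : ℕ∞) (pd i h) Ω :=
  dirD_contDiffOn hΩ hh _

lemma legVal_contDiffOn {Ω : Set (Fin 2 → ℝ)} (hΩ : IsOpen Ω) {f : (Fin 2 → ℝ) → ℝ}
    (hf : ContDiffOn ℝ (⊤ : ℕ∞) f Ω) : ContDiffOn ℝ (⊤ : ℕ∞) (legVal f) Ω :=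
  (((contDiffOn_coord 0).mul (pd_contDiffOn hΩ hf 0)).add
    ((contDiffOn_coord 1).mul (pd_contDiffOn hΩ hf 1))).sub hf

section LowerBound

variable {Ω : Set (Fin 2 → ℝ)} {C : ℝ} {f u : (Fin 2 → ℝ) → ℝ}

lemma neg_zero_le_legVal (hN : NormalizedDomain Ω) (hS : SClass Ω C f) {x : Fin 2 → ℝ}
    (hx : x ∈ Ω) : -f 0 ≤ legVal f x := by
  have h := tangent_le hN.1 hN.2.1 hS.1 hS.2.1 hx (hN.zero_mem)
  rw [dirD_eq_coord] at h
  simp at h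
  unfold legVal
  linarith

lemma exists_gradv_eq (hN : NormalizedDomain Ω) (hS : SClass Ω C f)
    {δ t : ℝ} (ht0 : 0 < t) (ht1 : t ≤ 1) (htδ : t * (10 * C) ≤ δ)
    {w : Fin 2 → ℝ} (hw : |w 0| + |w 1| < t * (C / 6)) :
    ∃ z ∈ Ω, legVal f z < -f 0 + δ ∧ gradv f z = (1 - t) • gradv f 0 + w := by
  set p := (1 - t) • gradv f 0 + w with hp
  have hwx : ∀ x ∈ closure Ω, |w 0 * x 0 + w 1 * x 1| ≤ |w 0| + |w 1| := fun x hx => by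
    refine (abs_add_le _ _).trans (add_le_add ?_ ?_) <;> rw [abs_mul]
    · exact mul_le_of_le_one_right (abs_nonneg _) (abs_coord_le_of_mem_closure hN hx 0)
    · exact mul_le_of_le_one_right (abs_nonneg _) (abs_coord_le_of_mem_closure hN hx 1)
  have hpx : ∀ x : Fin 2 → ℝ, p 0 * x 0 + p 1 * x 1 =
      (1 - t) * (x 0 * pd 0 f 0 + x 1 * pd 1 f 0) + (w 0 * x 0 + w 1 * x 1) := fun x => by
    simp [hp, gradv]; ring
  obtain ⟨z, hz, hmin⟩ := (isCompact_closure hN).exists_isMinOn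
    (f := fun x => f x - (p 0 * x 0 + p 1 * x 1)) ⟨0, subset_closure (hN.zero_mem)⟩
    (hS.2.2.2.1.sub (by fun_prop))
  have h0 := hmin (subset_closure (hN.zero_mem))
  simp only [Set.mem_ofPred_eq, Pi.zero_apply, mul_zero, add_zero, sub_zero] at h0
  have hzb := boundary_le hN hS hz
  rw [dirD_eq_coord] at hzb
  have hz1 := hpx z
  have hw3 := abs_le.1 (hwx z hz)
  have hzΩ : z ∈ Ω := by
    by_contra hzn
    have hfz : f z = C := hS.2.2.2.2 z ⟨hz, by rwa [hN.1.interior_eq]⟩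
    have hf0 := zero_le_of_SClass hN hS
    nlinarith
  have hg : gradv f z = p := by
    have hL : HasFDerivAt (fun x : Fin 2 → ℝ => p 0 * x 0 + p 1 * x 1)
        (p 0 • ContinuousLinearMap.proj (R := ℝ) (φ := fun _ : Fin 2 => ℝ) 0 +
          p 1 • ContinuousLinearMap.proj (R := ℝ) (φ := fun _ : Fin 2 => ℝ) 1) z :=
      ((hasFDerivAt_apply 0 z).const_mul _).add ((hasFDerivAt_apply 1 z).const_mul _)
    have hmin' : IsLocalMin (fun x => f x - (p 0 * x 0 + p 1 * x 1)) z := by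
      filter_upwards [hN.1.mem_nhds hzΩ] with y hy using hmin (subset_closure hy)
    have h1 := hmin'.hasFDerivAt_eq_zero
      ((differentiableAt_of_contDiffOn hN.1 hS.1 hzΩ).hasFDerivAt.sub hL)
    ext i
    have h2 := congrArg (fun T => T (Pi.single i 1)) h1
    fin_cases i <;> simpa [gradv, pd, sub_eq_zero] using h2
  refine ⟨z, hzΩ, ?_, hg⟩
  have ha := abs_gradv_zero_le hN hS
  have hq : |z 0 * pd 0 f 0 + z 1 * pd 1 f 0| ≤ 5 * C := by
    refine le_trans ((abs_add_le _ _).trans (add_le_add ?_ ?_)) ha <;> rw [abs_mul]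
    · exact mul_le_of_le_one_left (abs_nonneg _) (abs_coord_le_of_mem_closure hN hz 0)
    · exact mul_le_of_le_one_left (abs_nonneg _) (abs_coord_le_of_mem_closure hN hz 1)
  have hq' := (abs_le.1 hq).1
  have e0 : pd 0 f z = p 0 := congrFun hg 0
  have e1 : pd 1 f z = p 1 := congrFun hg 1
  unfold legVal
  rw [e0, e1]
  nlinarith

lemma gradv_hasFDerivAt (hΩ : IsOpen Ω) (hf : ContDiffOn ℝ (⊤ : ℕ∞) f Ω) {x : Fin 2 → ℝ}
    (hx : x ∈ Ω) :
    HasFDerivAt (gradv f) (LinearMap.toContinuousLinearMap (Matrix.toLin' (hess f x))) x := by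
  rw [hasFDerivAt_pi']
  intro i
  have hd := (differentiableAt_of_contDiffOn hΩ (pd_contDiffOn hΩ hf i) hx).hasFDerivAt
  refine hd.congr_fderiv ?_
  ext v
  change dirD v (pd i f) x = _
  rw [dirD_eq_coord]
  simp only [ContinuousLinearMap.comp_apply, LinearMap.coe_toContinuousLinearMap',
    Matrix.toLin'_apply, ContinuousLinearMap.proj_apply, Matrix.mulVec, dotProduct,
    Fin.sum_univ_two, hess, Matrix.of_apply]
  have hc : ∀ j, pd j (pd i f) x = pd i (pd j f) x := fun j => dirD_comm hΩ hf _ _ hx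
  rw [hc, hc]
  ring

/-- The set of gradients at points where the Legendre transform is small contains a square of
definite size, so an upper bound for the Hessian determinant there bounds `δ` below. -/
lemma sq_le_of_det_le (hC : 0 < C) (hN : NormalizedDomain Ω) (hS : SClass Ω C f)
    {δ r M : ℝ} (hδ : 0 < δ) (hr : 0 < r) (hr1 : r ≤ δ / 60) (hr2 : r ≤ C / 6)
    (hM : ∀ x ∈ Ω, legVal f x < -f 0 + δ → (hess f x).det ≤ M) : r ^ 2 ≤ 4 * M := by
  set T : Set (Fin 2 → ℝ) := {x ∈ Ω | legVal f x < -f 0 + δ} with hT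
  obtain ⟨t, ht0, ht1, htδ, htr⟩ : ∃ t : ℝ, 0 < t ∧ t ≤ 1 ∧ t * (10 * C) ≤ δ ∧
      r ≤ t * (C / 6) := by
    rcases le_total (δ / (10 * C)) 1 with h | h
    · refine ⟨δ / (10 * C), by positivity, h, by field_simp; rfl, ?_⟩
      rw [show δ / (10 * C) * (C / 6) = δ / 60 by field_simp; norm_num]
      exact hr1
    · refine ⟨1, one_pos, le_rfl, ?_, by linarith⟩
      rwa [le_div_iff₀ (by positivity)] at h
  set p := (1 - t) • gradv f 0 with hp
  have hTopen : IsOpen T := by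
    have := (legVal_contDiffOn hN.1 hS.1).continuousOn.isOpen_inter_preimage hN.1
      (isOpen_Iio (a := -f 0 + δ))
    exact this
  have hsub : Set.univ.pi (fun i => Set.Ioo (p i - r / 2) (p i + r / 2)) ⊆ gradv f '' T := by
    intro q hq
    have hq' : ∀ i, |(q - p) i| < r / 2 := fun i => by
      have := hq i trivial
      simp only [Pi.sub_apply]
      rw [abs_lt]
      constructor <;> linarith [this.1, this.2]
    have h0 := hq' 0
    have h1 := hq' 1
    obtain ⟨z, hz, hz1, hz2⟩ := exists_gradv_eq hN hS ht0 ht1 htδ (w := q - p)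
      (by linarith)
    refine ⟨z, ⟨hz, hz1⟩, ?_⟩
    rw [hz2, ← hp]; abel
  have hvol : MeasureTheory.volume (Set.univ.pi (fun i => Set.Ioo (p i - r / 2) (p i + r / 2))) =
      ENNReal.ofReal (r ^ 2) := by
    rw [Real.volume_pi_Ioo, Fin.prod_univ_two, ← ENNReal.ofReal_mul (by linarith)]
    congr 1; ring
  have hTvol : MeasureTheory.volume T ≤ ENNReal.ofReal 4 := by
    have : T ⊆ Set.Icc (fun _ => (-1 : ℝ)) (fun _ => 1) := fun x hx =>
      ⟨fun i => (abs_le.1 (abs_coord_le_of_mem_closure hN (subset_closure hx.1) i)).1,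
        fun i => (abs_le.1 (abs_coord_le_of_mem_closure hN (subset_closure hx.1) i)).2⟩
    refine (MeasureTheory.measure_mono this).trans ?_
    rw [Real.volume_Icc_pi, Fin.prod_univ_two, ← ENNReal.ofReal_mul (by norm_num)]
    norm_num
  have hM0 : 0 ≤ M := (hS.2.1 0 (hN.zero_mem)).det_pos.le.trans
    (hM 0 (hN.zero_mem) (by rw [legVal_zero]; linarith))
  have hJ := MeasureTheory.addHaar_image_le_lintegral_abs_det_fderiv MeasureTheory.volume
    hTopen.measurableSet (f := gradv f)
    (fun x hx => (gradv_hasFDerivAt hN.1 hS.1 hx.1).hasFDerivWithinAt)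
  have hI : ∫⁻ x in T, ENNReal.ofReal
      |(LinearMap.toContinuousLinearMap (Matrix.toLin' (hess f x))).det| ≤
      ENNReal.ofReal M * ENNReal.ofReal 4 := by
    refine le_trans (MeasureTheory.setLIntegral_mono' (g := fun _ => ENNReal.ofReal M)
      hTopen.measurableSet fun x hx => ?_) ?_
    · refine ENNReal.ofReal_le_ofReal ?_
      rw [ContinuousLinearMap.det, LinearMap.coe_toContinuousLinearMap, LinearMap.det_toLin',
        abs_of_pos (hS.2.1 x hx.1).det_pos]
      exact hM x hx.1 hx.2
    · rw [MeasureTheory.setLIntegral_const]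
      gcongr
  have hfin : ENNReal.ofReal (r ^ 2) ≤ ENNReal.ofReal (M * 4) := by
    rw [ENNReal.ofReal_mul hM0, ← hvol]
    exact (MeasureTheory.measure_mono hsub).trans (hJ.trans hI)
  rw [ENNReal.ofReal_le_ofReal_iff (by positivity)] at hfin
  linarith

lemma det_lt_of_rho {d b : ℝ} {x : Fin 2 → ℝ} (hp : (hess f x).PosDef) (hU : 0 < d)
    (h : 1 / (rho f x * d) < b) : (hess f x).det < (b * d) ^ 4 := by
  have hdet := hp.det_pos
  have hρ : rho f x ^ 4 = ((hess f x).det)⁻¹ := by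
    unfold rho
    rw [← Real.rpow_natCast, ← Real.rpow_mul hdet.le, ← Real.rpow_neg_one]
    norm_num
  have hρ0 : 0 < rho f x := Real.rpow_pos_of_pos hdet _
  rw [div_lt_iff₀ (by positivity)] at h
  have h4 : 1 < (b * (rho f x * d)) ^ 4 := one_lt_pow₀ h (by norm_num)
  rw [show (b * (rho f x * d)) ^ 4 = rho f x ^ 4 * (b * d) ^ 4 by ring, hρ,
    ← div_eq_inv_mul, one_lt_div hdet] at h4
  exact h4

/-- A positive lower bound for `d + u`, in terms of `C` and `b` only. -/
lemma le_add_legVal {d b : ℝ} (hC : 0 < C) (hb : 0 < b) (hN : NormalizedDomain Ω)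
    (hS : SClass Ω C f) (hpos : ∀ x ∈ Ω, 0 < d + legVal f x)
    (hρ : ∀ x ∈ Ω, 1 / (rho f x * (d + legVal f x)) < b) {x : Fin 2 → ℝ} (hx : x ∈ Ω) :
    min (10 * C) (1 / (480 * b ^ 2)) ≤ d + legVal f x := by
  set δ := d - f 0 with hδdef
  have hδ : 0 < δ := by
    have := hpos 0 (hN.zero_mem)
    rw [legVal_zero] at this
    linarith
  have hle : δ ≤ d + legVal f x := by linarith [neg_zero_le_legVal hN hS hx]
  refine le_trans ?_ hle
  have hM : ∀ x ∈ Ω, legVal f x < -f 0 + δ → (hess f x).det ≤ (b * (2 * δ)) ^ 4 := by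
    intro x hx hlt
    refine (det_lt_of_rho (hS.2.1 x hx) (hpos x hx) (hρ x hx)).le.trans ?_
    have := hpos x hx
    gcongr
    linarith
  rcases le_total (C / 6) (δ / 60) with h | h
  · exact (min_le_left _ _).trans (by linarith)
  · refine (min_le_right _ _).trans ?_
    have h2 := sq_le_of_det_le hC hN hS hδ (r := δ / 60) (by positivity) le_rfl h hM
    have h3 : δ / 60 ≤ 8 * b ^ 2 * δ ^ 2 := by
      refine (sq_le_sq₀ (by positivity) (by positivity)).1 ?_
      nlinarith
    rw [div_le_iff₀ (by positivity)]
    have h4 : δ * 1 ≤ δ * (δ * (480 * b ^ 2)) := by nlinarith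
    exact le_of_mul_le_mul_left h4 hδ

end LowerBound

/-- The logarithm of `ρ`. -/
noncomputable def logRho (f : (Fin 2 → ℝ) → ℝ) (x : Fin 2 → ℝ) : ℝ :=
  -(1 / 4) * Real.log (hess f x).det

section LogRho

variable {Ω : Set (Fin 2 → ℝ)} {f : (Fin 2 → ℝ) → ℝ} {β : ℝ}

lemma rho_eq_exp (hp : ∀ x ∈ Ω, (hess f x).PosDef) {x : Fin 2 → ℝ} (hx : x ∈ Ω) :
    rho f x = Real.exp (logRho f x) := by
  unfold rho logRho
  rw [Real.rpow_def_of_pos (hp x hx).det_pos]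
  congr 1
  push_cast
  ring

lemma det_eq_exp (hp : ∀ x ∈ Ω, (hess f x).PosDef) {x : Fin 2 → ℝ} (hx : x ∈ Ω) :
    (hess f x).det = Real.exp (-4 * logRho f x) := by
  unfold logRho
  rw [show -4 * (-(1 / 4) * Real.log (hess f x).det) = Real.log (hess f x).det by ring,
    Real.exp_log (hp x hx).det_pos]

lemma hess_contDiffOn (hΩ : IsOpen Ω) (hf : ContDiffOn ℝ (⊤ : ℕ∞) f Ω) (i j : Fin 2) :
    ContDiffOn ℝ (⊤ : ℕ∞) (fun x => hess f x i j) Ω :=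
  pd_contDiffOn hΩ (pd_contDiffOn hΩ hf j) i

lemma logRho_contDiffOn (hΩ : IsOpen Ω) (hf : ContDiffOn ℝ (⊤ : ℕ∞) f Ω)
    (hp : ∀ x ∈ Ω, (hess f x).PosDef) : ContDiffOn ℝ (⊤ : ℕ∞) (logRho f) Ω := by
  have h : ContDiffOn ℝ (⊤ : ℕ∞) (fun x => (hess f x).det) Ω := by
    simp only [Matrix.det_fin_two]
    exact ((hess_contDiffOn hΩ hf 0 0).mul (hess_contDiffOn hΩ hf 1 1)).sub
      ((hess_contDiffOn hΩ hf 0 1).mul (hess_contDiffOn hΩ hf 1 0))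
  exact contDiffOn_const.mul (h.log fun x hx => (hp x hx).det_pos.ne')

lemma hess_inv (hΩ : IsOpen Ω) (hf : ContDiffOn ℝ (⊤ : ℕ∞) f Ω) {x : Fin 2 → ℝ} (hx : x ∈ Ω) :
    (hess f x)⁻¹ = (hess f x).det⁻¹ • !![hess f x 1 1, -hess f x 0 1;
      -hess f x 0 1, hess f x 0 0] := by
  rw [Matrix.inv_def, Matrix.adjugate_fin_two, Ring.inverse_eq_inv', hess_symm hΩ hf hx]

lemma gradSq_mul_det (hΩ : IsOpen Ω) (hf : ContDiffOn ℝ (⊤ : ℕ∞) f Ω)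
    (hp : ∀ x ∈ Ω, (hess f x).PosDef) (h : (Fin 2 → ℝ) → ℝ) {x : Fin 2 → ℝ} (hx : x ∈ Ω) :
    gradSq f h x * (hess f x).det = hess f x 1 1 * pd 0 h x ^ 2 -
      2 * hess f x 0 1 * pd 0 h x * pd 1 h x + hess f x 0 0 * pd 1 h x ^ 2 := by
  have hd := (hp x hx).det_pos.ne'
  unfold gradSq
  rw [hess_inv hΩ hf hx]
  simp only [Fin.sum_univ_two, Matrix.smul_apply, smul_eq_mul, Matrix.of_apply,
    Matrix.cons_val', Matrix.cons_val_zero, Matrix.cons_val_one, Matrix.cons_val_fin_one]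
  field_simp
  ring

lemma pd_exp_logRho (hΩ : IsOpen Ω) (hf : ContDiffOn ℝ (⊤ : ℕ∞) f Ω)
    (hp : ∀ x ∈ Ω, (hess f x).PosDef) (i : Fin 2) {x : Fin 2 → ℝ} (hx : x ∈ Ω) :
    pd i (rho f) x = Real.exp (logRho f x) * pd i (logRho f) x := by
  have hd := differentiableAt_of_contDiffOn hΩ (logRho_contDiffOn hΩ hf hp) hx
  rw [pd_eq_dirD, dirD_congr hΩ (fun y hy => rho_eq_exp hp hy) _ hx]
  unfold dirD
  rw [fderiv_exp hd]
  rfl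

lemma Phi_eq_gradSq (hΩ : IsOpen Ω) (hf : ContDiffOn ℝ (⊤ : ℕ∞) f Ω)
    (hp : ∀ x ∈ Ω, (hess f x).PosDef) {x : Fin 2 → ℝ} (hx : x ∈ Ω) :
    Phi f x = gradSq f (logRho f) x := by
  have hd := (hp x hx).det_pos.ne'
  have h1 := gradSq_mul_det hΩ hf hp (rho f) hx
  have h2 := gradSq_mul_det hΩ hf hp (logRho f) hx
  simp only [pd_exp_logRho hΩ hf hp _ hx] at h1
  unfold Phi
  rw [rho_eq_exp hp hx, div_eq_iff (by positivity), ← mul_left_inj' hd, h1]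
  linear_combination (-Real.exp (logRho f x) ^ 2) * h2

lemma PDE2.log_form (hΩ : IsOpen Ω) (hf : ContDiffOn ℝ (⊤ : ℕ∞) f Ω)
    (hp : ∀ x ∈ Ω, (hess f x).PosDef) (hpde : PDE2 f β Ω) {x : Fin 2 → ℝ} (hx : x ∈ Ω) :
    hess f x 1 1 * hess (logRho f) x 0 0 - 2 * hess f x 0 1 * hess (logRho f) x 0 1 +
        hess f x 0 0 * hess (logRho f) x 1 1 =
      -(β + 3) * (hess f x 1 1 * pd 0 (logRho f) x ^ 2 -
        2 * hess f x 0 1 * pd 0 (logRho f) x * pd 1 (logRho f) x +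
          hess f x 0 0 * pd 1 (logRho f) x ^ 2) := by
  set σ := logRho f with hσ
  have hσc : ContDiffOn ℝ (⊤ : ℕ∞) σ Ω := logRho_contDiffOn hΩ hf hp
  have hsqrt : ∀ y ∈ Ω, Real.sqrt (hess f y).det = Real.exp (-2 * σ y) := fun y hy => by
    rw [det_eq_exp hp hy, show -4 * logRho f y = -2 * σ y + -2 * σ y by rw [hσ]; ring,
      Real.exp_add, Real.sqrt_mul_self (Real.exp_pos _).le]
  have key : ∀ (i j : Fin 2) (k : (Fin 2 → ℝ) → ℝ), ContDiffOn ℝ (⊤ : ℕ∞) k Ω →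
      (∀ y ∈ Ω, (hess f y)⁻¹ i j = (hess f y).det⁻¹ * k y) →
      pd i (fun y => Real.sqrt (hess f y).det * (hess f y)⁻¹ i j * pd j (rho f) y) x =
        Real.exp (3 * σ x) * (3 * pd i σ x * k x * pd j σ x + pd i k x * pd j σ x +
          k x * pd i (pd j σ) x) := by
    intro i j k hk hinv
    have e : ∀ y ∈ Ω, Real.sqrt (hess f y).det * (hess f y)⁻¹ i j * pd j (rho f) y =
        Real.exp (3 * σ y) * (k y * pd j σ y) := fun y hy => by
      rw [hsqrt y hy, hinv y hy, pd_exp_logRho hΩ hf hp j hy, det_eq_exp hp hy, ← hσ,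
        ← Real.exp_neg, show 3 * σ y = -2 * σ y + -(-4 * σ y) + σ y by ring, Real.exp_add,
        Real.exp_add]
      ring
    rw [pd_eq_dirD, dirD_congr hΩ e _ hx]
    have d1 := hasDerivAt_line_zero hΩ hσc hx (Pi.single i 1)
    have d2 := hasDerivAt_line_zero hΩ hk hx (Pi.single i 1)
    have d3 := hasDerivAt_line_zero hΩ (pd_contDiffOn hΩ hσc j) hx (Pi.single i 1)
    have hc : ContDiffOn ℝ (⊤ : ℕ∞) (fun y => Real.exp (3 * σ y) * (k y * pd j σ y)) Ω :=
      (contDiffOn_const.mul hσc).exp.mul (hk.mul (pd_contDiffOn hΩ hσc j))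
    have d4 := hasDerivAt_line_zero hΩ hc hx (Pi.single i 1)
    rw [d4.unique (((d1.const_mul 3).exp).mul (d2.mul d3))]
    simp only [zero_smul, add_zero, ← pd_eq_dirD]
    ring
  have h := hpde x hx
  have hH : ∀ i j, ContDiffOn ℝ (⊤ : ℕ∞) (fun x => hess f x i j) Ω := hess_contDiffOn hΩ hf
  unfold calabiLap at h
  simp only [Fin.sum_univ_two] at h
  rw [key 0 0 (fun x => hess f x 1 1) (hH 1 1) (fun y hy => by rw [hess_inv hΩ hf hy]; simp),
    key 0 1 (fun x => -hess f x 0 1) (hH 0 1).neg (fun y hy => by rw [hess_inv hΩ hf hy]; simp),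
    key 1 0 (fun x => -hess f x 0 1) (hH 0 1).neg (fun y hy => by rw [hess_inv hΩ hf hy]; simp),
    key 1 1 (fun x => hess f x 0 0) (hH 0 0) (fun y hy => by rw [hess_inv hΩ hf hy]; simp)] at h
  have hneg : ∀ i, pd i (fun x => -hess f x 0 1) x = -pd i (fun x => hess f x 0 1) x := fun i => by
    simp [pd, fderiv_fun_neg]
  have c1 : pd 1 (fun x => hess f x 0 1) x = pd 0 (fun x => hess f x 1 1) x :=
    dirD_comm hΩ (pd_contDiffOn hΩ hf 1) _ _ hx
  have c2 : pd 1 (fun x => hess f x 0 0) x = pd 0 (fun x => hess f x 0 1) x := by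
    refine (dirD_comm hΩ (pd_contDiffOn hΩ hf 0) _ _ hx).trans ?_
    exact dirD_congr hΩ (fun y hy => hess_symm hΩ hf hy) _ hx
  have c3 : pd 1 (pd 0 σ) x = pd 0 (pd 1 σ) x := dirD_comm hΩ hσc _ _ hx
  have hG : gradSq f (rho f) x = Real.exp (2 * σ x) * gradSq f σ x := by
    have := Phi_eq_gradSq hΩ hf hp hx
    unfold Phi at this
    rw [div_eq_iff (by rw [rho_eq_exp hp hx]; positivity), rho_eq_exp hp hx] at this
    rw [this, ← hσ, two_mul, Real.exp_add]
    ring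
  have hQ := gradSq_mul_det hΩ hf hp σ hx
  rw [hneg, hneg, c1, c2, c3, hsqrt x hx, hG, rho_eq_exp hp hx, ← hσ] at h
  rw [det_eq_exp hp hx, ← hσ] at hQ
  have hE : gradSq f σ x = Real.exp (4 * σ x) * (hess f x 1 1 * pd 0 σ x ^ 2 -
      2 * hess f x 0 1 * pd 0 σ x * pd 1 σ x + hess f x 0 0 * pd 1 σ x ^ 2) := by
    rw [← hQ, mul_comm, mul_assoc, ← Real.exp_add]
    simp
  rw [hE] at h
  set E := Real.exp (σ x) with hEdef
  have hEpos : 0 < E := Real.exp_pos _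
  have e2 : Real.exp (2 * σ x) = E ^ 2 := by rw [hEdef, ← Real.exp_nat_mul]; norm_num
  have e3 : Real.exp (3 * σ x) = E ^ 3 := by rw [hEdef, ← Real.exp_nat_mul]; norm_num
  have e4 : Real.exp (4 * σ x) = E ^ 4 := by rw [hEdef, ← Real.exp_nat_mul]; norm_num
  have e5 : (Real.exp (-2 * σ x))⁻¹ = E ^ 2 := by
    rw [← Real.exp_neg, ← e2]; ring_nf
  rw [e2, e3, e4, e5] at h
  simp only [hess, Matrix.of_apply] at h ⊢
  rw [eq_div_iff hEpos.ne'] at h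
  have hE6 : E ^ 6 ≠ 0 := by positivity
  apply mul_left_cancel₀ hE6
  linear_combination h

end LogRho

/-- The second order jet of the squared norm `φ` of a covector `(p, q)` with respect to the
metric `(a, b; b, c)`, at a point where the metric is the standard one. -/
lemma TwoJet.quad {φ a b c p q : ℝ → ℝ} {φ₁ φ₂ a₁ a₂ b₁ b₂ c₁ c₂ p₁ p₂ q₁ q₂ : ℝ}
    (hφ : TwoJet φ φ₁ φ₂) (ha : TwoJet a a₁ a₂) (hb : TwoJet b b₁ b₂) (hc : TwoJet c c₁ c₂)
    (hp : TwoJet p p₁ p₂) (hq : TwoJet q q₁ q₂) (ha0 : a 0 = 1) (hb0 : b 0 = 0) (hc0 : c 0 = 1)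
    (h : ∀ᶠ t in 𝓝 0, φ t * (a t * c t - b t * b t) =
      c t * (p t * p t) - 2 * (b t * (p t * q t)) + a t * (q t * q t)) :
    φ₁ = 2 * (p 0 * p₁ + q 0 * q₁) - (a₁ * p 0 ^ 2 + 2 * b₁ * p 0 * q 0 + c₁ * q 0 ^ 2) ∧
    φ₂ = 2 * (p₁ ^ 2 + q₁ ^ 2 + p 0 * p₂ + q 0 * q₂) -
      (a₂ * p 0 ^ 2 + 2 * b₂ * p 0 * q 0 + c₂ * q 0 ^ 2) -
      4 * (a₁ * p 0 * p₁ + b₁ * (p 0 * q₁ + q 0 * p₁) + c₁ * q 0 * q₁) +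
      2 * ((a₁ * p 0 + b₁ * q 0) ^ 2 + (b₁ * p 0 + c₁ * q 0) ^ 2) := by
  have hl := (hφ.mul ((ha.mul hc).sub (hb.mul hb))).congr h
  have hr := ((hc.mul (hp.mul hp)).sub ((hb.mul (hp.mul hq)).const_mul 2)).add
    (ha.mul (hq.mul hq))
  obtain ⟨h1, h2⟩ := hl.unique hr
  have h0 := h.self_of_nhds
  simp only [ha0, hb0, hc0] at h0 h1 h2
  have e0 : φ 0 = p 0 ^ 2 + q 0 ^ 2 := by linear_combination h0
  rw [e0] at h1 h2
  have e1 : φ₁ = 2 * (p 0 * p₁ + q 0 * q₁) -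
      (a₁ * p 0 ^ 2 + 2 * b₁ * p 0 * q 0 + c₁ * q 0 ^ 2) := by linear_combination h1
  refine ⟨e1, ?_⟩
  rw [e1] at h2
  linear_combination h2

section Frame

variable {Ω : Set (Fin 2 → ℝ)} {f : (Fin 2 → ℝ) → ℝ} {β : ℝ}

lemma frame_quad (hΩ : IsOpen Ω) (hf : ContDiffOn ℝ (⊤ : ℕ∞) f Ω) (v w : Fin 2 → ℝ)
    (h : (Fin 2 → ℝ) → ℝ) {x : Fin 2 → ℝ} (hx : x ∈ Ω) :
    dirD w (dirD w f) x * dirD v h x ^ 2 - 2 * dirD v (dirD w f) x * dirD v h x * dirD w h x +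
      dirD v (dirD v f) x * dirD w h x ^ 2 = (v 0 * w 1 - v 1 * w 0) ^ 2 *
      (hess f x 1 1 * pd 0 h x ^ 2 - 2 * hess f x 0 1 * pd 0 h x * pd 1 h x +
        hess f x 0 0 * pd 1 h x ^ 2) := by
  simp only [dirD_dirD_coord hΩ hf _ _ hx, dirD_eq_coord]
  ring

lemma frame_lap (hΩ : IsOpen Ω) (hf : ContDiffOn ℝ (⊤ : ℕ∞) f Ω) (v w : Fin 2 → ℝ)
    {h : (Fin 2 → ℝ) → ℝ} (hh : ContDiffOn ℝ (⊤ : ℕ∞) h Ω) {x : Fin 2 → ℝ} (hx : x ∈ Ω) :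
    dirD w (dirD w f) x * dirD v (dirD v h) x -
      2 * dirD v (dirD w f) x * dirD v (dirD w h) x +
      dirD v (dirD v f) x * dirD w (dirD w h) x = (v 0 * w 1 - v 1 * w 0) ^ 2 *
      (hess f x 1 1 * hess h x 0 0 - 2 * hess f x 0 1 * hess h x 0 1 +
        hess f x 0 0 * hess h x 1 1) := by
  simp only [dirD_dirD_coord hΩ hf _ _ hx, dirD_dirD_coord hΩ hh _ _ hx]
  ring

lemma frame_det (hΩ : IsOpen Ω) (hf : ContDiffOn ℝ (⊤ : ℕ∞) f Ω) (v w : Fin 2 → ℝ)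
    {x : Fin 2 → ℝ} (hx : x ∈ Ω) :
    dirD v (dirD v f) x * dirD w (dirD w f) x - dirD v (dirD w f) x * dirD v (dirD w f) x =
      (v 0 * w 1 - v 1 * w 0) ^ 2 * (hess f x).det := by
  simp only [dirD_dirD_coord hΩ hf _ _ hx, Matrix.det_fin_two, hess_symm hΩ hf hx]
  ring

lemma frame_gradSq (hΩ : IsOpen Ω) (hf : ContDiffOn ℝ (⊤ : ℕ∞) f Ω)
    (hp : ∀ x ∈ Ω, (hess f x).PosDef) (v w : Fin 2 → ℝ) (h : (Fin 2 → ℝ) → ℝ) {x : Fin 2 → ℝ}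
    (hx : x ∈ Ω) :
    gradSq f h x * (dirD v (dirD v f) x * dirD w (dirD w f) x -
        dirD v (dirD w f) x * dirD v (dirD w f) x) =
      dirD w (dirD w f) x * (dirD v h x * dirD v h x) -
        2 * (dirD v (dirD w f) x * (dirD v h x * dirD w h x)) +
        dirD v (dirD v f) x * (dirD w h x * dirD w h x) := by
  have h1 := frame_quad hΩ hf v w h hx
  have h2 := gradSq_mul_det hΩ hf hp h hx
  rw [frame_det hΩ hf v w hx]
  linear_combination -h1 + (v 0 * w 1 - v 1 * w 0) ^ 2 * h2

lemma frame_pde (hΩ : IsOpen Ω) (hf : ContDiffOn ℝ (⊤ : ℕ∞) f Ω)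
    (hp : ∀ x ∈ Ω, (hess f x).PosDef) (hpde : PDE2 f β Ω) (v w : Fin 2 → ℝ) {x : Fin 2 → ℝ}
    (hx : x ∈ Ω) :
    dirD w (dirD w f) x * dirD v (dirD v (logRho f)) x -
      2 * dirD v (dirD w f) x * dirD v (dirD w (logRho f)) x +
      dirD v (dirD v f) x * dirD w (dirD w (logRho f)) x =
    -(β + 3) * (dirD w (dirD w f) x * dirD v (logRho f) x ^ 2 -
      2 * dirD v (dirD w f) x * dirD v (logRho f) x * dirD w (logRho f) x +
      dirD v (dirD v f) x * dirD w (logRho f) x ^ 2) := by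
  rw [frame_quad hΩ hf v w _ hx, frame_lap hΩ hf v w (logRho_contDiffOn hΩ hf hp) hx,
    hpde.log_form hΩ hf hp hx]
  ring

/-- A pair of vectors that is orthonormal at `p` for the Hessian metric of `f`, the second one
being tangent to the level set of `f`. -/
structure IsAdaptedFrame (f : (Fin 2 → ℝ) → ℝ) (p v w : Fin 2 → ℝ) : Prop where
  vv : dirD v (dirD v f) p = 1
  vw : dirD v (dirD w f) p = 0
  ww : dirD w (dirD w f) p = 1
  dv : dirD v f p = Real.sqrt (gradSq f f p)
  dw : dirD w f p = 0

lemma exists_isAdaptedFrame (hΩ : IsOpen Ω) (hf : ContDiffOn ℝ (⊤ : ℕ∞) f Ω)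
    (hp : ∀ x ∈ Ω, (hess f x).PosDef) {p : Fin 2 → ℝ} (hpΩ : p ∈ Ω) :
    ∃ v w, IsAdaptedFrame f p v w := by
  obtain ⟨ξ, hξ0, hξ⟩ : ∃ ξ : Fin 2 → ℝ, ξ ≠ 0 ∧ dirD ξ f p = 0 := by
    by_cases h : pd 0 f p = 0
    · refine ⟨Pi.single 0 1, by simp, h⟩
    · refine ⟨![-pd 1 f p, pd 0 f p], fun h0 => h (by simpa using congrFun h0 1), ?_⟩
      rw [dirD_eq_coord]; simp; ring
  set H := hess f p
  set η : Fin 2 → ℝ := ![-(ξ 0 * H 0 1 + ξ 1 * H 1 1), ξ 0 * H 0 0 + ξ 1 * H 0 1] with hη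
  have hηξ : dirD η (dirD ξ f) p = 0 := by
    rw [dirD_dirD_coord hΩ hf _ _ hpΩ]; simp [hη, H]; ring
  have hξξ := dirD_dirD_pos hΩ hf hp hpΩ hξ0
  have hη0 : η ≠ 0 := by
    intro h
    have h0 : -(ξ 0 * H 0 1 + ξ 1 * H 1 1) = 0 := by simpa [hη] using congrFun h 0
    have h1 : ξ 0 * H 0 0 + ξ 1 * H 0 1 = 0 := by simpa [hη] using congrFun h 1
    rw [dirD_dirD_coord hΩ hf _ _ hpΩ] at hξξ
    have : ξ 0 * ξ 0 * H 0 0 + (ξ 0 * ξ 1 + ξ 1 * ξ 0) * H 0 1 + ξ 1 * ξ 1 * H 1 1 = 0 := by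
      linear_combination ξ 0 * h1 - ξ 1 * h0
    exact hξξ.ne' this
  have hηη := dirD_dirD_pos hΩ hf hp hpΩ hη0
  have hsm : ∀ (a b : ℝ) (v w : Fin 2 → ℝ), dirD (a • v) (dirD (b • w) f) p =
      a * b * dirD v (dirD w f) p := fun a b v w => by
    simp only [dirD_dirD_coord hΩ hf _ _ hpΩ, Pi.smul_apply, smul_eq_mul]; ring
  have hsq : ∀ {r : ℝ}, 0 < r → (Real.sqrt r)⁻¹ * (Real.sqrt r)⁻¹ * r = 1 := fun {r} hr => by
    rw [← mul_inv, Real.mul_self_sqrt hr.le, inv_mul_cancel₀ hr.ne']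
  have hw : dirD ((Real.sqrt (dirD ξ (dirD ξ f) p))⁻¹ • ξ) f p = 0 := by
    have : dirD ξ f p = 0 := hξ
    simp only [dirD, map_smul, smul_eq_mul] at this ⊢
    rw [this, mul_zero]
  obtain ⟨e, he, hey⟩ : ∃ e : ℝ, e * e = 1 ∧
      0 ≤ e * dirD ((Real.sqrt (dirD η (dirD η f) p))⁻¹ • η) f p := by
    rcases le_total 0 (dirD ((Real.sqrt (dirD η (dirD η f) p))⁻¹ • η) f p) with h | h
    · exact ⟨1, by norm_num, by simpa using h⟩
    · exact ⟨-1, by norm_num, by simpa using h⟩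
  have hvv : dirD ((e * (Real.sqrt (dirD η (dirD η f) p))⁻¹) • η)
      (dirD ((e * (Real.sqrt (dirD η (dirD η f) p))⁻¹) • η) f) p = 1 := by
    have h1 := hsq hηη
    rw [hsm]
    linear_combination ((Real.sqrt (dirD η (dirD η f) p))⁻¹ *
      (Real.sqrt (dirD η (dirD η f) p))⁻¹ * dirD η (dirD η f) p) * he + h1
  have hvw : dirD ((e * (Real.sqrt (dirD η (dirD η f) p))⁻¹) • η)
      (dirD ((Real.sqrt (dirD ξ (dirD ξ f) p))⁻¹ • ξ) f) p = 0 := by rw [hsm, hηξ, mul_zero]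
  have hww : dirD ((Real.sqrt (dirD ξ (dirD ξ f) p))⁻¹ • ξ)
      (dirD ((Real.sqrt (dirD ξ (dirD ξ f) p))⁻¹ • ξ) f) p = 1 := by rw [hsm, hsq hξξ]
  refine ⟨_, _, hvv, hvw, hww, ?_, hw⟩
  have hG := frame_gradSq hΩ hf hp ((e * (Real.sqrt (dirD η (dirD η f) p))⁻¹) • η)
    ((Real.sqrt (dirD ξ (dirD ξ f) p))⁻¹ • ξ) f hpΩ
  rw [hvv, hvw, hww, hw] at hG
  have hG' : gradSq f f p = dirD ((e * (Real.sqrt (dirD η (dirD η f) p))⁻¹) • η) f p ^ 2 := by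
    linear_combination hG
  rw [hG', Real.sqrt_sq]
  rw [mul_smul]
  simpa [dirD] using hey

end Frame

/-- The relations between the derivatives, at a point and in an orthonormal frame, of `f`
(third derivatives `tᵢ`, traces `Fᵢⱼ` of the fourth derivatives) and of `log ρ`
(derivatives `sᵢ`, `sᵢⱼ`, traces `rᵢ` of the third derivatives) that the equation implies. -/
structure JetRel (B s1 s2 s11 s12 s22 r1 r2 t0 t1 t2 t3 F11 F12 F22 : ℝ) : Prop where
  tr1 : t0 + t2 = -4 * s1
  tr2 : t1 + t3 = -4 * s2
  four11 : F11 = -4 * s11 + (t0 ^ 2 + 2 * t1 ^ 2 + t2 ^ 2)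
  four12 : F12 = -4 * s12 + (t0 * t1 + 2 * t1 * t2 + t2 * t3)
  four22 : F22 = -4 * s22 + (t1 ^ 2 + 2 * t2 ^ 2 + t3 ^ 2)
  lap : s11 + s22 = -(B + 2) * (s1 ^ 2 + s2 ^ 2)
  lap1 : t2 * s11 - 2 * t1 * s12 + t0 * s22 + r1 =
    -(B + 2) * (t2 * s1 ^ 2 - 2 * t1 * s1 * s2 + t0 * s2 ^ 2 + 2 * s1 * s11 + 2 * s2 * s12)
  lap2 : t3 * s11 - 2 * t2 * s12 + t1 * s22 + r2 =
    -(B + 2) * (t3 * s1 ^ 2 - 2 * t2 * s1 * s2 + t1 * s2 ^ 2 + 2 * s1 * s12 + 2 * s2 * s22)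

section Frame

variable {Ω : Set (Fin 2 → ℝ)} {f : (Fin 2 → ℝ) → ℝ} {β : ℝ}

lemma dirD_comm3 (hΩ : IsOpen Ω) {h : (Fin 2 → ℝ) → ℝ} (hh : ContDiffOn ℝ (⊤ : ℕ∞) h Ω)
    (v w : Fin 2 → ℝ) {x : Fin 2 → ℝ} (hx : x ∈ Ω) :
    dirD w (dirD v (dirD v h)) x = dirD v (dirD v (dirD w h)) x :=
  (dirD_comm hΩ (dirD_contDiffOn hΩ hh v) w v hx).trans
    (dirD_congr hΩ (fun _ hy => dirD_comm hΩ hh w v hy) v hx)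

lemma dirD_comm3' (hΩ : IsOpen Ω) {h : (Fin 2 → ℝ) → ℝ} (hh : ContDiffOn ℝ (⊤ : ℕ∞) h Ω)
    (v w : Fin 2 → ℝ) {x : Fin 2 → ℝ} (hx : x ∈ Ω) :
    dirD w (dirD v (dirD w h)) x = dirD v (dirD w (dirD w h)) x :=
  dirD_comm hΩ (dirD_contDiffOn hΩ hh w) w v hx

lemma dirD_comm3'' (hΩ : IsOpen Ω) {h : (Fin 2 → ℝ) → ℝ} (hh : ContDiffOn ℝ (⊤ : ℕ∞) h Ω)
    (v w : Fin 2 → ℝ) {x : Fin 2 → ℝ} (hx : x ∈ Ω) :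
    dirD w (dirD w (dirD v h)) x = dirD v (dirD w (dirD w h)) x :=
  (dirD_congr hΩ (fun _ hy => dirD_comm hΩ hh w v hy) w hx).trans (dirD_comm3' hΩ hh v w hx)

lemma dirD_comm4 (hΩ : IsOpen Ω) {h : (Fin 2 → ℝ) → ℝ} (hh : ContDiffOn ℝ (⊤ : ℕ∞) h Ω)
    (v w : Fin 2 → ℝ) {x : Fin 2 → ℝ} (hx : x ∈ Ω) :
    dirD w (dirD w (dirD v (dirD v h))) x = dirD v (dirD v (dirD w (dirD w h))) x :=
  (dirD_congr hΩ (fun _ hy => dirD_comm3 hΩ hh v w hy) w hx).trans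
    (dirD_comm3 hΩ (dirD_contDiffOn hΩ hh w) v w hx)

lemma dirD_comm4' (hΩ : IsOpen Ω) {h : (Fin 2 → ℝ) → ℝ} (hh : ContDiffOn ℝ (⊤ : ℕ∞) h Ω)
    (v w : Fin 2 → ℝ) {x : Fin 2 → ℝ} (hx : x ∈ Ω) :
    dirD w (dirD w (dirD v (dirD w h))) x = dirD v (dirD w (dirD w (dirD w h))) x :=
  dirD_comm3'' hΩ (dirD_contDiffOn hΩ hh w) v w hx

lemma jetRel_of_frame (hΩ : IsOpen Ω) (hf : ContDiffOn ℝ (⊤ : ℕ∞) f Ω)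
    (hp : ∀ x ∈ Ω, (hess f x).PosDef) (hpde : PDE2 f β Ω) {p v w : Fin 2 → ℝ} (hpΩ : p ∈ Ω)
    (hF : IsAdaptedFrame f p v w) :
    JetRel (β + 1) (dirD v (logRho f) p) (dirD w (logRho f) p) (dirD v (dirD v (logRho f)) p)
      (dirD v (dirD w (logRho f)) p) (dirD w (dirD w (logRho f)) p)
      (dirD v (dirD v (dirD v (logRho f))) p + dirD v (dirD w (dirD w (logRho f))) p)
      (dirD v (dirD v (dirD w (logRho f))) p + dirD w (dirD w (dirD w (logRho f))) p)
      (dirD v (dirD v (dirD v f)) p) (dirD v (dirD v (dirD w f)) p)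
      (dirD v (dirD w (dirD w f)) p) (dirD w (dirD w (dirD w f)) p)
      (dirD v (dirD v (dirD v (dirD v f))) p + dirD v (dirD v (dirD w (dirD w f))) p)
      (dirD v (dirD v (dirD v (dirD w f))) p + dirD v (dirD w (dirD w (dirD w f))) p)
      (dirD v (dirD v (dirD w (dirD w f))) p + dirD w (dirD w (dirD w (dirD w f))) p) := by
  set σ := logRho f with hσdef
  have hσ : ContDiffOn ℝ (⊤ : ℕ∞) σ Ω := logRho_contDiffOn hΩ hf hp
  have hV : ∀ {h : (Fin 2 → ℝ) → ℝ}, ContDiffOn ℝ (⊤ : ℕ∞) h Ω →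
      ContDiffOn ℝ (⊤ : ℕ∞) (dirD v h) Ω := fun hh => dirD_contDiffOn hΩ hh v
  have hW : ∀ {h : (Fin 2 → ℝ) → ℝ}, ContDiffOn ℝ (⊤ : ℕ∞) h Ω →
      ContDiffOn ℝ (⊤ : ℕ∞) (dirD w h) Ω := fun hh => dirD_contDiffOn hΩ hh w
  set k := (v 0 * w 1 - v 1 * w 0) ^ 2 with hk
  have hdet : ∀ x ∈ Ω, dirD v (dirD v f) x * dirD w (dirD w f) x -
      dirD v (dirD w f) x * dirD v (dirD w f) x = k * Real.exp (-4 * σ x) := fun x hx => by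
    rw [frame_det hΩ hf v w hx, det_eq_exp hp hx]
  have hk1 : k * Real.exp (-4 * σ p) = 1 := by
    rw [← hdet p hpΩ, hF.vv, hF.vw, hF.ww]; norm_num
  have jσ := TwoJet.of_contDiffOn hΩ hσ hpΩ
  -- the determinant identity, differentiated twice along the frame
  have jdet : ∀ e : Fin 2 → ℝ, TwoJet (fun t => k * Real.exp (-4 * σ (p + t • e)))
      (-4 * dirD e σ p) (16 * dirD e σ p ^ 2 - 4 * dirD e (dirD e σ) p) := fun e => by
    convert (((jσ e).const_mul (-4)).exp).const_mul k using 1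
    · simp only [zero_smul, add_zero]; linear_combination -(-4 * dirD e σ p) * hk1
    · simp only [zero_smul, add_zero]
      linear_combination -(16 * dirD e σ p ^ 2 - 4 * dirD e (dirD e σ) p) * hk1
  have jl : ∀ e : Fin 2 → ℝ, _ := fun e =>
    (((TwoJet.of_contDiffOn hΩ (hV (hV hf)) hpΩ e).mul
      (TwoJet.of_contDiffOn hΩ (hW (hW hf)) hpΩ e)).sub
      ((TwoJet.of_contDiffOn hΩ (hV (hW hf)) hpΩ e).mul
        (TwoJet.of_contDiffOn hΩ (hV (hW hf)) hpΩ e))).congr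
      ((eventually_line hΩ hpΩ e).mono fun t ht => hdet _ ht)
  obtain ⟨a1, a2⟩ := (jl v).unique (jdet v)
  obtain ⟨b1, b2⟩ := (jl w).unique (jdet w)
  simp only [zero_smul, add_zero, hF.vv, hF.vw, hF.ww] at a1 a2 b1 b2
  rw [dirD_comm3 hΩ hf v w hpΩ, dirD_comm3' hΩ hf v w hpΩ] at b2
  rw [dirD_comm3 hΩ hf v w hpΩ] at b1
  rw [dirD_comm4 hΩ hf v w hpΩ, dirD_comm4' hΩ hf v w hpΩ] at b2
  have tr1 : dirD v (dirD v (dirD v f)) p + dirD v (dirD w (dirD w f)) p = -4 * dirD v σ p := by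
    linear_combination a1
  have tr2 : dirD v (dirD v (dirD w f)) p + dirD w (dirD w (dirD w f)) p = -4 * dirD w σ p := by
    linear_combination b1
  have hs1 : dirD v σ p = -(1 / 4) * (dirD v (dirD v (dirD v f)) p +
    dirD v (dirD w (dirD w f)) p) := by linear_combination (1 / 4) * tr1
  have hs2 : dirD w σ p = -(1 / 4) * (dirD v (dirD v (dirD w f)) p +
    dirD w (dirD w (dirD w f)) p) := by linear_combination (1 / 4) * tr2
  -- the mixed second derivative of the determinant identity
  have hmix : ∀ x ∈ Ω, dirD v (dirD v (dirD v f)) x * dirD w (dirD w f) x +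
      dirD v (dirD v f) x * dirD v (dirD w (dirD w f)) x -
      2 * (dirD v (dirD w f) x * dirD v (dirD v (dirD w f)) x) =
      dirD v σ x * (-4 * (k * Real.exp (-4 * σ x))) := fun x hx => by
    have h0 := hasDerivAt_line_zero hΩ (hV (hV hf)) hx v
    have h1 := hasDerivAt_line_zero hΩ (hW (hW hf)) hx v
    have h2 := hasDerivAt_line_zero hΩ (hV (hW hf)) hx v
    have h3 := ((hasDerivAt_line_zero hΩ hσ hx v).const_mul (-4)).exp.const_mul k
    have h4 := ((h0.mul h1).sub (h2.mul h2)).unique (h3.congr_of_eventuallyEq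
      ((eventually_line hΩ hx v).mono fun t ht => hdet _ ht))
    simp only [zero_smul, add_zero] at h4
    linear_combination h4
  have hmix' : dirD v (dirD v (dirD v (dirD w f))) p + dirD v (dirD w (dirD w (dirD w f))) p =
      -4 * dirD v (dirD w σ) p + (dirD v (dirD v (dirD v f)) p * dirD v (dirD v (dirD w f)) p +
      2 * dirD v (dirD v (dirD w f)) p * dirD v (dirD w (dirD w f)) p +
      dirD v (dirD w (dirD w f)) p * dirD w (dirD w (dirD w f)) p) := by
    have h0 := hasDerivAt_line_zero hΩ (hV (hV (hV hf))) hpΩ w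
    have h1 := hasDerivAt_line_zero hΩ (hW (hW hf)) hpΩ w
    have h2 := hasDerivAt_line_zero hΩ (hV (hV hf)) hpΩ w
    have h3 := hasDerivAt_line_zero hΩ (hV (hW (hW hf))) hpΩ w
    have h4 := hasDerivAt_line_zero hΩ (hV (hW hf)) hpΩ w
    have h5 := hasDerivAt_line_zero hΩ (hV (hV (hW hf))) hpΩ w
    have h6 := hasDerivAt_line_zero hΩ (hV hσ) hpΩ w
    have h7 := ((hasDerivAt_line_zero hΩ hσ hpΩ w).const_mul (-4)).exp.const_mul k
    have h8 := (((h0.mul h1).add (h2.mul h3)).sub ((h4.mul h5).const_mul 2)).unique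
      ((h6.mul (h7.const_mul (-4))).congr_of_eventuallyEq
        ((eventually_line hΩ hpΩ w).mono fun t ht => hmix _ ht))
    simp only [zero_smul, add_zero, hF.vv, hF.vw, hF.ww] at h8
    have g1 : dirD w (dirD v (dirD v (dirD v f))) p = dirD v (dirD v (dirD v (dirD w f))) p :=
      (dirD_comm3 hΩ (hV hf) v w hpΩ).trans (dirD_congr hΩ (fun y hy =>
        dirD_congr hΩ (fun z hz => dirD_comm hΩ hf w v hz) v hy) v hpΩ)
    have g2 : dirD w (dirD v (dirD w (dirD w f))) p = dirD v (dirD w (dirD w (dirD w f))) p :=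
      dirD_comm hΩ (hW (hW hf)) w v hpΩ
    rw [g1, g2, dirD_comm hΩ hσ w v hpΩ, dirD_comm3 hΩ hf v w hpΩ,
      dirD_comm3' hΩ hf v w hpΩ] at h8
    linear_combination h8 + (16 * dirD v σ p * dirD w σ p - 4 * dirD v (dirD w σ) p) * hk1 +
      4 * dirD v σ p * tr2 - tr1 * (dirD v (dirD v (dirD w f)) p + dirD w (dirD w (dirD w f)) p)
  -- the equation and its first derivatives
  have hE := fun x hx => frame_pde hΩ hf hp hpde v w (x := x) hx
  have hEd : ∀ e : Fin 2 → ℝ, _ := fun e =>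
    ((((hasDerivAt_line_zero hΩ (hW (hW hf)) hpΩ e).mul
      (hasDerivAt_line_zero hΩ (hV (hV hσ)) hpΩ e)).sub
      (((hasDerivAt_line_zero hΩ (hV (hW hf)) hpΩ e).const_mul 2).mul
        (hasDerivAt_line_zero hΩ (hV (hW hσ)) hpΩ e))).add
      ((hasDerivAt_line_zero hΩ (hV (hV hf)) hpΩ e).mul
        (hasDerivAt_line_zero hΩ (hW (hW hσ)) hpΩ e))).unique
    ((((((hasDerivAt_line_zero hΩ (hW (hW hf)) hpΩ e).mul
      ((hasDerivAt_line_zero hΩ (hV hσ) hpΩ e).pow 2)).sub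
      ((((hasDerivAt_line_zero hΩ (hV (hW hf)) hpΩ e).const_mul 2).mul
        (hasDerivAt_line_zero hΩ (hV hσ) hpΩ e)).mul
          (hasDerivAt_line_zero hΩ (hW hσ) hpΩ e))).add
      ((hasDerivAt_line_zero hΩ (hV (hV hf)) hpΩ e).mul
        ((hasDerivAt_line_zero hΩ (hW hσ) hpΩ e).pow 2))).const_mul (-(β + 3))).congr_of_eventuallyEq
        ((eventually_line hΩ hpΩ e).mono fun t ht => hE _ ht))
  have e1 := hEd v
  have e2 := hEd w
  have e0 := hE p hpΩ
  simp only [zero_smul, add_zero, hF.vv, hF.vw, hF.ww, Pi.mul_apply, Pi.pow_apply] at e0 e1 e2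
  rw [dirD_comm3 hΩ hσ v w hpΩ, dirD_comm3' hΩ hσ v w hpΩ, dirD_comm3 hΩ hf v w hpΩ,
    dirD_comm3' hΩ hf v w hpΩ, dirD_comm hΩ hσ w v hpΩ] at e2
  refine ⟨tr1, tr2, ?_, hmix', ?_, ?_, ?_, ?_⟩
  · rw [hs1] at a2; linear_combination a2
  · rw [hs2] at b2; linear_combination b2
  · linear_combination e0
  · push_cast at e1; linear_combination e1
  · push_cast at e2; linear_combination e2

end Frame

section JetAlgebra

variable {B s1 s2 s11 s12 s22 r1 r2 t0 t1 t2 t3 F11 F12 F22 : ℝ}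

/-- The first derivative of `‖grad log ρ‖²` through the trace-free part `(x, z)` of the
covariant Hessian of `log ρ`. -/
lemma JetRel.phi_first (h : JetRel B s1 s2 s11 s12 s22 r1 r2 t0 t1 t2 t3 F11 F12 F22) {x z : ℝ}
    (hx : x = s11 - (t0 * s1 + t1 * s2) / 2 + B * (s1 ^ 2 + s2 ^ 2) / 2)
    (hz : z = s12 - (t1 * s1 + t2 * s2) / 2) :
    2 * (s1 * s11 + s2 * s12) - (t0 * s1 ^ 2 + 2 * t1 * s1 * s2 + t2 * s2 ^ 2) =
      2 * (x * s1 + z * s2) - B * (s1 ^ 2 + s2 ^ 2) * s1 ∧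
    2 * (s1 * s12 + s2 * s22) - (t1 * s1 ^ 2 + 2 * t2 * s1 * s2 + t3 * s2 ^ 2) =
      2 * (z * s1 - x * s2) - B * (s1 ^ 2 + s2 ^ 2) * s2 := by
  constructor
  · rw [hx, hz]; ring
  · have e22 : s22 = -(B + 2) * (s1 ^ 2 + s2 ^ 2) - s11 := by linear_combination h.lap
    have e0 : t0 = -4 * s1 - t2 := by linear_combination h.tr1
    have e3 : t3 = -4 * s2 - t1 := by linear_combination h.tr2
    rw [hx, hz, e22, e0, e3]; ring

/-- A Bochner inequality for `‖grad log ρ‖²`. -/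
lemma JetRel.phi_second (h : JetRel B s1 s2 s11 s12 s22 r1 r2 t0 t1 t2 t3 F11 F12 F22) {x z : ℝ}
    (hx : x = s11 - (t0 * s1 + t1 * s2) / 2 + B * (s1 ^ 2 + s2 ^ 2) / 2)
    (hz : z = s12 - (t1 * s1 + t2 * s2) / 2) :
    4 * (x ^ 2 + z ^ 2) + 3 * B ^ 2 * (s1 ^ 2 + s2 ^ 2) ^ 2 -
      4 * B * (x * (s1 ^ 2 - s2 ^ 2) + 2 * z * s1 * s2) - (s1 ^ 2 + s2 ^ 2) ^ 2 ≤
    2 * (s11 ^ 2 + s12 ^ 2 + s12 ^ 2 + s22 ^ 2 + s1 * r1 + s2 * r2) -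
      (F11 * s1 ^ 2 + 2 * F12 * s1 * s2 + F22 * s2 ^ 2) -
      4 * (t0 * s1 * s11 + t1 * (s1 * s12 + s2 * s11) + t2 * s2 * s12 +
        (t1 * s1 * s12 + t2 * (s1 * s22 + s2 * s12) + t3 * s2 * s22)) +
      2 * ((t0 * s1 + t1 * s2) ^ 2 + (t1 * s1 + t2 * s2) ^ 2 +
        ((t1 * s1 + t2 * s2) ^ 2 + (t2 * s1 + t3 * s2) ^ 2)) +
      2 * (s1 * (2 * (x * s1 + z * s2) - B * (s1 ^ 2 + s2 ^ 2) * s1) +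
        s2 * (2 * (z * s1 - x * s2) - B * (s1 ^ 2 + s2 ^ 2) * s2)) := by
  have e22 : s22 = -(B + 2) * (s1 ^ 2 + s2 ^ 2) - s11 := by linear_combination h.lap
  have e0 : t0 = -4 * s1 - t2 := by linear_combination h.tr1
  have e3 : t3 = -4 * s2 - t1 := by linear_combination h.tr2
  have er1 := h.lap1
  have er2 := h.lap2
  rw [← eq_sub_iff_add_eq'] at er1 er2
  have e11 : s11 = x + (t0 * s1 + t1 * s2) / 2 - B * (s1 ^ 2 + s2 ^ 2) / 2 := by
    linear_combination -hx
  have e12 : s12 = z + (t1 * s1 + t2 * s2) / 2 := by linear_combination -hz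
  have hk : 0 ≤ ((t1 + s2) ^ 2 + (t2 + s1) ^ 2) * (s1 ^ 2 + s2 ^ 2) := by positivity
  rw [er1, er2, h.four11, h.four12, h.four22, e22, e3, e12, e11, e0]
  rw [← sub_nonneg]
  refine hk.trans_eq ?_
  ring

end JetAlgebra

/-- The second order jets at `p`, in an adapted frame `(v, w)`, of `log ρ`, `f`, the Legendre
value, `Φ` and `‖grad f‖²`, together with the relations between them. The numbers `x, z` are the
components of the trace-free covariant Hessian of `log ρ`, and `t₀, t₁, t₂` are third derivatives
of `f`. -/
structure PointJets (B : ℝ) (f : (Fin 2 → ℝ) → ℝ) (p v w : Fin 2 → ℝ) where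
  (s1 s2 s11 s22 X1 X2 u11 u22 P1 P2 p11 p22 x z t0 t1 t2 q11 q22 y : ℝ)
  σv : TwoJet (fun t => logRho f (p + t • v)) s1 s11
  σw : TwoJet (fun t => logRho f (p + t • w)) s2 s22
  fv : TwoJet (fun t => f (p + t • v)) y 1
  fw : TwoJet (fun t => f (p + t • w)) 0 1
  Uv : TwoJet (fun t => legVal f (p + t • v)) X1 u11
  Uw : TwoJet (fun t => legVal f (p + t • w)) X2 u22
  Φv : TwoJet (fun t => Phi f (p + t • v)) P1 p11
  Φw : TwoJet (fun t => Phi f (p + t • w)) P2 p22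
  Ψv : TwoJet (fun t => gradSq f f (p + t • v)) (2 * y - t0 * y ^ 2) q11
  Ψw : TwoJet (fun t => gradSq f f (p + t • w)) (-(t1 * y ^ 2)) q22
  y_nonneg : 0 ≤ y
  Φ_eq : Phi f p = s1 ^ 2 + s2 ^ 2
  Ψ_eq : gradSq f f p = y ^ 2
  tr_t : t0 + t2 = -4 * s1
  tr_σ : s11 + s22 = -(B + 2) * (s1 ^ 2 + s2 ^ 2)
  s11_eq : s11 = x + (t0 * s1 + t1 * s2) / 2 - B * (s1 ^ 2 + s2 ^ 2) / 2
  tr_U : u11 + u22 = 2 - 4 * (X1 * s1 + X2 * s2)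
  X1_mul : X1 * y = legVal f p + f p
  P1_eq : P1 = 2 * (x * s1 + z * s2) - B * (s1 ^ 2 + s2 ^ 2) * s1
  P2_eq : P2 = 2 * (z * s1 - x * s2) - B * (s1 ^ 2 + s2 ^ 2) * s2
  tr_Φ : 4 * (x ^ 2 + z ^ 2) + 3 * B ^ 2 * (s1 ^ 2 + s2 ^ 2) ^ 2 -
      4 * B * (x * (s1 ^ 2 - s2 ^ 2) + 2 * z * s1 * s2) - (s1 ^ 2 + s2 ^ 2) ^ 2 ≤
    p11 + p22 + 2 * (s1 * P1 + s2 * P2)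
  tr_Ψ : q11 + q22 = 4 + 8 * y * s1 + 4 * s11 * y ^ 2 + y ^ 2 * (t0 ^ 2 + 2 * t1 ^ 2 + t2 ^ 2)

section PointJets

variable {Ω : Set (Fin 2 → ℝ)} {f : (Fin 2 → ℝ) → ℝ} {β : ℝ}

lemma gradSq_contDiffOn (hΩ : IsOpen Ω) (hf : ContDiffOn ℝ (⊤ : ℕ∞) f Ω)
    (hp : ∀ x ∈ Ω, (hess f x).PosDef) {h : (Fin 2 → ℝ) → ℝ} (hh : ContDiffOn ℝ (⊤ : ℕ∞) h Ω) :
    ContDiffOn ℝ (⊤ : ℕ∞) (gradSq f h) Ω := by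
  have hH := hess_contDiffOn hΩ hf
  have hP := fun i => pd_contDiffOn hΩ hh i
  have hdet : ContDiffOn ℝ (⊤ : ℕ∞) (fun x => hess f x 0 0 * hess f x 1 1 -
      hess f x 0 1 * hess f x 1 0) Ω :=
    ((hH 0 0).mul (hH 1 1)).sub ((hH 0 1).mul (hH 1 0))
  have hn : ContDiffOn ℝ (⊤ : ℕ∞) (fun x => hess f x 1 1 * pd 0 h x ^ 2 -
      2 * hess f x 0 1 * pd 0 h x * pd 1 h x + hess f x 0 0 * pd 1 h x ^ 2) Ω :=
    (((hH 1 1).mul ((hP 0).pow 2)).sub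
      (((contDiffOn_const.mul (hH 0 1)).mul (hP 0)).mul (hP 1))).add
      ((hH 0 0).mul ((hP 1).pow 2))
  refine (hn.div hdet fun x hx => ?_).congr fun x hx => ?_
  · rw [← Matrix.det_fin_two]; exact (hp x hx).det_pos.ne'
  · have h1 := gradSq_mul_det hΩ hf hp h hx
    have h2 := (hp x hx).det_pos.ne'
    rw [Matrix.det_fin_two] at h1 h2
    exact (eq_div_iff h2).2 h1

lemma exists_pointJets (hΩ : IsOpen Ω) (hf : ContDiffOn ℝ (⊤ : ℕ∞) f Ω)
    (hp : ∀ x ∈ Ω, (hess f x).PosDef) (hpde : PDE2 f β Ω) {p v w : Fin 2 → ℝ} (hpΩ : p ∈ Ω)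
    (hF : IsAdaptedFrame f p v w) : Nonempty (PointJets (β + 1) f p v w) := by
  have hJ := jetRel_of_frame hΩ hf hp hpde hpΩ hF
  set σ := logRho f with hσdef
  have hσ : ContDiffOn ℝ (⊤ : ℕ∞) σ Ω := logRho_contDiffOn hΩ hf hp
  have hD : ∀ {h : (Fin 2 → ℝ) → ℝ} (e : Fin 2 → ℝ), ContDiffOn ℝ (⊤ : ℕ∞) h Ω →
      ContDiffOn ℝ (⊤ : ℕ∞) (dirD e h) Ω := fun e hh => dirD_contDiffOn hΩ hh e
  have J : ∀ {h : (Fin 2 → ℝ) → ℝ} (_ : ContDiffOn ℝ (⊤ : ℕ∞) h Ω) (e : Fin 2 → ℝ),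
      TwoJet (fun t => h (p + t • e)) (dirD e h p) (dirD e (dirD e h) p) :=
    fun hh e => TwoJet.of_contDiffOn hΩ hh hpΩ e
  have hΦc := gradSq_contDiffOn hΩ hf hp hσ
  have hΨc := gradSq_contDiffOn hΩ hf hp hf
  have Q : ∀ {h : (Fin 2 → ℝ) → ℝ} (hh : ContDiffOn ℝ (⊤ : ℕ∞) h Ω) (e : Fin 2 → ℝ), _ :=
    fun {h} hh e => (J (gradSq_contDiffOn hΩ hf hp hh) e).quad (J (hD v (hD v hf)) e)
      (J (hD v (hD w hf)) e) (J (hD w (hD w hf)) e) (J (hD v hh) e) (J (hD w hh) e)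
      (by simp [hF.vv]) (by simp [hF.vw]) (by simp [hF.ww])
      ((eventually_line hΩ hpΩ e).mono fun t ht => frame_gradSq hΩ hf hp v w h ht)
  obtain ⟨Φv1, Φv2⟩ := Q hσ v
  obtain ⟨Φw1, Φw2⟩ := Q hσ w
  obtain ⟨Ψv1, Ψv2⟩ := Q hf v
  obtain ⟨Ψw1, Ψw2⟩ := Q hf w
  simp only [zero_smul, add_zero] at Φv1 Φv2 Φw1 Φw2 Ψv1 Ψv2 Ψw1 Ψw2
  have c1 := dirD_comm hΩ hσ w v hpΩ
  have c2 := dirD_comm hΩ hf w v hpΩ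
  rw [dirD_comm3 hΩ hf v w hpΩ, dirD_comm3' hΩ hf v w hpΩ] at Φw1 Ψw1
  rw [dirD_comm3 hΩ hf v w hpΩ, dirD_comm3' hΩ hf v w hpΩ, dirD_comm4 hΩ hf v w hpΩ,
    dirD_comm4' hΩ hf v w hpΩ] at Φw2 Ψw2
  rw [c1] at Φw1 Φw2
  rw [c2] at Ψw1 Ψw2
  rw [dirD_comm3'' hΩ hσ v w hpΩ] at Φw2
  rw [dirD_comm3'' hΩ hf v w hpΩ] at Ψw2
  simp only [hF.vv, hF.vw, hF.ww, hF.dw] at Ψv1 Ψv2 Ψw1 Ψw2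
  have hΦ0 := frame_gradSq hΩ hf hp v w σ hpΩ
  have hΨ0 := frame_gradSq hΩ hf hp v w f hpΩ
  simp only [hF.vv, hF.vw, hF.ww, hF.dw] at hΦ0 hΨ0
  have hk : (v 0 * w 1 - v 1 * w 0) ≠ 0 := fun h0 => by
    have := frame_det hΩ hf v w hpΩ
    rw [hF.vv, hF.vw, hF.ww, h0] at this
    norm_num at this
  obtain ⟨X1, X2, hX⟩ : ∃ X1 X2 : ℝ, p = X1 • v + X2 • w := by
    refine ⟨(p 0 * w 1 - p 1 * w 0) / (v 0 * w 1 - v 1 * w 0),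
      (v 0 * p 1 - v 1 * p 0) / (v 0 * w 1 - v 1 * w 0), ?_⟩
    ext i
    simp only [Pi.add_apply, Pi.smul_apply, smul_eq_mul]
    rw [div_mul_eq_mul_div, div_mul_eq_mul_div, ← add_div, eq_div_iff hk]
    fin_cases i <;> simp <;> ring
  have hU : ∀ x : Fin 2 → ℝ, ∀ a b : ℝ, x = a • v + b • w →
      legVal f x = a * dirD v f x + b * dirD w f x - f x := fun x a b h => by
    rw [← dirD_comb, ← h, dirD_eq_coord, legVal]
  have hX0 := congrFun hX 0
  have hUv : TwoJet (fun t => legVal f (p + t • v)) X1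
      (1 + X1 * dirD v (dirD v (dirD v f)) p + X2 * dirD v (dirD v (dirD w f)) p) := by
    have jid : TwoJet (fun t : ℝ => X1 + t) 1 0 :=
      ⟨fun _ => 1, Eventually.of_forall fun t => by simpa using (hasDerivAt_id t).const_add X1,
        rfl, hasDerivAt_const _ _⟩
    convert ((jid.mul (J (hD v hf) v)).add ((J (hD w hf) v).const_mul X2)).sub (J hf v) using 1
    · ext t
      refine hU _ _ _ ?_
      conv_lhs => rw [hX]
      module
    · simp [hF.vv, hF.vw]
    · simp [hF.vv]; ring
  have hUw : TwoJet (fun t => legVal f (p + t • w)) X2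
      (1 + X1 * dirD v (dirD w (dirD w f)) p + X2 * dirD w (dirD w (dirD w f)) p) := by
    have jid : TwoJet (fun t : ℝ => X2 + t) 1 0 :=
      ⟨fun _ => 1, Eventually.of_forall fun t => by simpa using (hasDerivAt_id t).const_add X2,
        rfl, hasDerivAt_const _ _⟩
    convert (((J (hD v hf) w).const_mul X1).add (jid.mul (J (hD w hf) w))).sub (J hf w) using 1
    · ext t
      refine hU _ _ _ ?_
      conv_lhs => rw [hX]
      module
    · simp [hF.vw, c2, hF.ww, hF.dw]
    · simp [dirD_comm3'' hΩ hf v w hpΩ, hF.ww]; ring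
  have hU0 := hU p X1 X2 hX
  rw [hF.dw] at hU0
  have hPe : ∀ e, (fun t : ℝ => gradSq f σ (p + t • e)) =ᶠ[𝓝 0] fun t => Phi f (p + t • e) :=
    fun e => (eventually_line hΩ hpΩ e).mono fun t ht => (Phi_eq_gradSq hΩ hf hp ht).symm
  have h1 := hJ.phi_first rfl rfl
  have h2 := hJ.phi_second rfl rfl
  refine ⟨{
    s1 := dirD v σ p, s2 := dirD w σ p, s11 := dirD v (dirD v σ) p, s22 := dirD w (dirD w σ) p
    X1 := X1, X2 := X2
    u11 := 1 + X1 * dirD v (dirD v (dirD v f)) p + X2 * dirD v (dirD v (dirD w f)) p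
    u22 := 1 + X1 * dirD v (dirD w (dirD w f)) p + X2 * dirD w (dirD w (dirD w f)) p
    P1 := dirD v (gradSq f σ) p, P2 := dirD w (gradSq f σ) p
    p11 := dirD v (dirD v (gradSq f σ)) p, p22 := dirD w (dirD w (gradSq f σ)) p
    x := dirD v (dirD v σ) p - (dirD v (dirD v (dirD v f)) p * dirD v σ p +
        dirD v (dirD v (dirD w f)) p * dirD w σ p) / 2 +
      (β + 1) * (dirD v σ p ^ 2 + dirD w σ p ^ 2) / 2
    z := dirD v (dirD w σ) p - (dirD v (dirD v (dirD w f)) p * dirD v σ p +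
        dirD v (dirD w (dirD w f)) p * dirD w σ p) / 2
    t0 := dirD v (dirD v (dirD v f)) p, t1 := dirD v (dirD v (dirD w f)) p
    t2 := dirD v (dirD w (dirD w f)) p
    q11 := dirD v (dirD v (gradSq f f)) p, q22 := dirD w (dirD w (gradSq f f)) p, y := dirD v f p
    σv := J hσ v, σw := J hσ w
    fv := by have := J hf v; rwa [hF.vv] at this
    fw := by have := J hf w; rwa [hF.ww, hF.dw] at this
    Uv := hUv, Uw := hUw, Φv := (J hΦc v).congr (hPe v), Φw := (J hΦc w).congr (hPe w)
    Ψv := ?_, Ψw := ?_, y_nonneg := ?_, Φ_eq := ?_, Ψ_eq := ?_, tr_t := hJ.tr1, tr_σ := hJ.lap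
    s11_eq := ?_, tr_U := ?_, X1_mul := ?_
    P1_eq := Φv1.trans h1.1, P2_eq := Φw1.trans h1.2, tr_Φ := ?_, tr_Ψ := ?_ }⟩
  · convert J hΨc v using 1
    rw [Ψv1]; ring
  · convert J hΨc w using 1
    rw [Ψw1]; ring
  · rw [hF.dv]; positivity
  · rw [Phi_eq_gradSq hΩ hf hp hpΩ]; linear_combination hΦ0
  · linear_combination hΨ0
  · ring
  · linear_combination X1 * hJ.tr1 + X2 * hJ.tr2
  · rw [hU0]; ring
  · rw [Φv1.trans h1.1, Φw1.trans h1.2]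
    refine h2.trans_eq ?_
    rw [Φv2, Φw2]; ring
  · rw [Ψv2, Ψw2]
    linear_combination (-2 * dirD v f p) * hJ.tr1 - dirD v f p ^ 2 * hJ.four11

end PointJets

/-- The logarithm of `exp(-m/(C-f)) / (ρ (d+u))^α`. -/
noncomputable def logWeight (C m α d : ℝ) (f : (Fin 2 → ℝ) → ℝ) (x : Fin 2 → ℝ) : ℝ :=
  -(m * (C - f x)⁻¹) - α * logRho f x - α * Real.log (d + legVal f x)

namespace PointJets

variable {B C m α d : ℝ} {f : (Fin 2 → ℝ) → ℝ} {p v w : Fin 2 → ℝ}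

lemma exists_logWeight (J : PointJets B f p v w) (hs : 0 < C - f p)
    (hD : 0 < d + legVal f p) :
    ∃ W1 W2 W11 W22 τ1 τ2 : ℝ,
      TwoJet (fun t => logWeight C m α d f (p + t • v)) W1 W11 ∧
      TwoJet (fun t => logWeight C m α d f (p + t • w)) W2 W22 ∧
      W1 = -(m / (C - f p) ^ 2 * J.y) - α * J.s1 - α * τ1 ∧
      W2 = -(α * J.s2) - α * τ2 ∧
      τ1 * J.y * (d + legVal f p) = legVal f p + f p ∧
      W11 + W22 + 2 * (J.s1 * W1 + J.s2 * W2) =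
        -(2 * (C - f p) / m * (m / (C - f p) ^ 2 * J.y) ^ 2) - 2 * (m / (C - f p) ^ 2) -
          2 * (m / (C - f p) ^ 2 * J.y * J.s1) - 2 * α / (d + legVal f p) +
          α * B * (J.s1 ^ 2 + J.s2 ^ 2) + 2 * α * (J.s1 * τ1 + J.s2 * τ2) +
          α * (τ1 ^ 2 + τ2 ^ 2) := by
  have h0 : ∀ (h : (Fin 2 → ℝ) → ℝ) (e : Fin 2 → ℝ), h (p + (0 : ℝ) • e) = h p := by simp
  have key : ∀ (e : Fin 2 → ℝ) (a b a' b' a'' b'' : ℝ), TwoJet (fun t => f (p + t • e)) a b →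
      TwoJet (fun t => logRho f (p + t • e)) a' b' →
      TwoJet (fun t => legVal f (p + t • e)) a'' b'' →
      TwoJet (fun t => logWeight C m α d f (p + t • e))
        (-(m / (C - f p) ^ 2 * a) - α * a' - α * (a'' / (d + legVal f p)))
        (-(m * (2 * a ^ 2 / (C - f p) ^ 3 + b / (C - f p) ^ 2)) - α * b' -
          α * (b'' / (d + legVal f p) - (a'' / (d + legVal f p)) ^ 2)) := by
    intro e a b a' b' a'' b'' h1 h2 h3
    have k1 := ((((h1.const_mul (-1)).const_add C).inv (by simpa using hs)).const_mul (-m))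
    have k2 := h2.const_mul α
    have k3 := ((h3.const_add d).log (by simpa using hD)).const_mul α
    simp only [zero_smul, add_zero] at k1 k3
    have hs' : 0 < C + -1 * f p := by linarith
    convert (k1.sub k2).sub k3 using 1
    · ext t; simp only [logWeight]; ring
    · rw [show C + -1 * f p = C - f p by ring]; field_simp
    · rw [show C + -1 * f p = C - f p by ring]; field_simp; ring
  refine ⟨_, _, _, _, J.X1 / (d + legVal f p), J.X2 / (d + legVal f p),
    key v _ _ _ _ _ _ J.fv J.σv J.Uv, key w _ _ _ _ _ _ J.fw J.σw J.Uw, rfl, by ring, ?_, ?_⟩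
  · rw [← J.X1_mul]; field_simp
  · have h1 := J.tr_σ
    have h2 := J.tr_U
    have h3 : J.s22 = -(B + 2) * (J.s1 ^ 2 + J.s2 ^ 2) - J.s11 := by linear_combination h1
    have h4 : J.u22 = 2 - 4 * (J.X1 * J.s1 + J.X2 * J.s2) - J.u11 := by linear_combination h2
    rw [h3, h4]
    field_simp
    ring

end PointJets

lemma IsLocalMax.line {h : (Fin 2 → ℝ) → ℝ} {p : Fin 2 → ℝ} (hm : IsLocalMax h p)
    (e : Fin 2 → ℝ) : IsLocalMax (fun t : ℝ => h (p + t • e)) 0 := by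
  have hc : ContinuousAt (fun t : ℝ => p + t • e) 0 := by fun_prop
  have hm' : ∀ᶠ y in 𝓝 (p + (0 : ℝ) • e), h y ≤ h p := by
    simpa using (show ∀ᶠ y in 𝓝 p, h y ≤ h p from hm)
  filter_upwards [hc.eventually hm'] with t ht
  simpa using ht

/-- The first and second order conditions at a maximum of `exp(φ) ψ`. -/
lemma TwoJet.exp_mul_of_isLocalMax {φ ψ : ℝ → ℝ} {a b c e : ℝ} (hφ : TwoJet φ a b)
    (hψ : TwoJet ψ c e) (hm : IsLocalMax (fun t => Real.exp (φ t) * ψ t) 0) :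
    a * ψ 0 + c = 0 ∧ (a ^ 2 + b) * ψ 0 + 2 * a * c + e ≤ 0 := by
  obtain ⟨h1, h2⟩ := (hφ.exp.mul hψ).of_isLocalMax hm
  have h0 := Real.exp_pos (φ 0)
  constructor
  · have : Real.exp (φ 0) * (a * ψ 0 + c) = 0 := by linear_combination h1
    exact (mul_eq_zero.1 this).resolve_left h0.ne'
  · by_contra! h
    have := mul_pos h0 h
    linarith

/-- The estimate of `Φ` at a maximum point of `exp(-m/(C-f)) Φ / (ρ (d+u))^α`. -/
lemma PointJets.phi_le_of_isLocalMax {B C m α d : ℝ} {f : (Fin 2 → ℝ) → ℝ} {p v w : Fin 2 → ℝ}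
    (J : PointJets B f p v w) (hB : 1 ≤ B) (hα : 0 ≤ α) (hs : 0 < C - f p)
    (hD : 0 < d + legVal f p) (hΦ : 0 < Phi f p)
    (hmax : IsLocalMax (fun x => Real.exp (logWeight C m α d f x) * Phi f x) p) :
    α * (B - 1) * Phi f p ≤ (1 + 2 * (C - f p) / m) * (m / (C - f p) ^ 2 * J.y) ^ 2 +
      2 * (m / (C - f p) ^ 2) + 2 * α / (d + legVal f p) := by
  obtain ⟨W1, W2, W11, W22, τ1, τ2, hv, hw, -, -, -, hΔ⟩ :=
    J.exists_logWeight (m := m) (α := α) hs hD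
  obtain ⟨a1, a2⟩ := hv.exp_mul_of_isLocalMax J.Φv (hmax.line v)
  obtain ⟨b1, b2⟩ := hw.exp_mul_of_isLocalMax J.Φw (hmax.line w)
  simp only [zero_smul, add_zero] at a1 a2 b1 b2
  have hP1 := J.P1_eq
  have hP2 := J.P2_eq
  have hT := J.tr_Φ
  rw [J.Φ_eq] at *
  set Φ := J.s1 ^ 2 + J.s2 ^ 2 with hΦdef
  set X := m / (C - f p) ^ 2 * J.y
  have e1 : J.P1 = -(W1 * Φ) := by linear_combination a1
  have e2 : J.P2 = -(W2 * Φ) := by linear_combination b1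
  have hWΦ : (W1 ^ 2 + W2 ^ 2) * Φ = 4 * (J.x ^ 2 + J.z ^ 2) -
      4 * B * (J.x * (J.s1 ^ 2 - J.s2 ^ 2) + 2 * J.z * J.s1 * J.s2) + B ^ 2 * Φ ^ 2 := by
    refine mul_right_cancel₀ hΦ.ne' ?_
    have : J.P1 ^ 2 + J.P2 ^ 2 = (W1 ^ 2 + W2 ^ 2) * Φ * Φ := by rw [e1, e2]; ring
    rw [← this, hP1, hP2, hΦdef]; ring
  rw [e1] at a2 hT
  rw [e2] at b2 hT
  have hmain : Φ * (W11 + W22 + 2 * (J.s1 * W1 + J.s2 * W2) + (2 * B ^ 2 - 1) * Φ) ≤ 0 := by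
    linarith
  have hle : W11 + W22 + 2 * (J.s1 * W1 + J.s2 * W2) + (2 * B ^ 2 - 1) * Φ ≤ 0 := by
    by_contra! h
    exact absurd (mul_pos hΦ h) (not_lt.2 hmain)
  rw [hΔ] at hle
  have k1 : 0 ≤ α * ((J.s1 + τ1) ^ 2 + (J.s2 + τ2) ^ 2) := by positivity
  have k2 : Φ ≤ (2 * B ^ 2 - 1) * Φ :=
    le_mul_of_one_le_left hΦ.le (by linarith [one_le_pow₀ (n := 2) hB])
  have k3 : 2 * (X * J.s1) ≤ X ^ 2 + Φ := by
    have := add_nonneg (sq_nonneg (X - J.s1)) (sq_nonneg J.s2)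
    rw [hΦdef]
    linarith [this, show (X - J.s1) ^ 2 + J.s2 ^ 2 =
      X ^ 2 + (J.s1 ^ 2 + J.s2 ^ 2) - 2 * (X * J.s1) by ring]
  have k4 : α * ((J.s1 + τ1) ^ 2 + (J.s2 + τ2) ^ 2) =
      α * Φ + 2 * α * (J.s1 * τ1 + J.s2 * τ2) + α * (τ1 ^ 2 + τ2 ^ 2) := by
    rw [hΦdef]; ring
  linarith

lemma le_weighted_bochner {B : ℝ} (hB : 1 ≤ B) (s1 s2 x z W1 W2 : ℝ) :
    x ^ 2 + z ^ 2 ≤ 4 * (x ^ 2 + z ^ 2) + 3 * B ^ 2 * (s1 ^ 2 + s2 ^ 2) ^ 2 -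
      4 * B * (x * (s1 ^ 2 - s2 ^ 2) + 2 * z * s1 * s2) - (s1 ^ 2 + s2 ^ 2) ^ 2 +
      2 * (W1 * (2 * (x * s1 + z * s2) - B * (s1 ^ 2 + s2 ^ 2) * s1) +
        W2 * (2 * (z * s1 - x * s2) - B * (s1 ^ 2 + s2 ^ 2) * s2)) +
      2 * ((W1 ^ 2 + W2 ^ 2) * (s1 ^ 2 + s2 ^ 2)) := by
  have h1 : 0 ≤ (B ^ 2 - 1) * (s1 ^ 2 + s2 ^ 2) ^ 2 :=
    mul_nonneg (by linarith [one_le_pow₀ (n := 2) hB]) (by positivity)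
  have h2 : 0 ≤ (x - B * (s1 ^ 2 - s2 ^ 2)) ^ 2 + (z - B * (2 * s1 * s2)) ^ 2 +
      2 * ((W1 * s1 - W2 * s2) + (2 * x - B * (s1 ^ 2 - s2 ^ 2)) / 2) ^ 2 +
      2 * ((W1 * s2 + W2 * s1) + (2 * z - B * (2 * s1 * s2)) / 2) ^ 2 +
      B ^ 2 * (s1 ^ 2 + s2 ^ 2) ^ 2 / 2 := by positivity
  rw [← sub_nonneg]
  refine (add_nonneg h1 h2).trans_eq ?_
  ring

lemma sq_first_deriv_le (B s1 s2 x z : ℝ) :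
    (2 * (x * s1 + z * s2) - B * (s1 ^ 2 + s2 ^ 2) * s1) ^ 2 ≤
      (s1 ^ 2 + s2 ^ 2) * (6 * (x ^ 2 + z ^ 2) + 3 * B ^ 2 * (s1 ^ 2 + s2 ^ 2) ^ 2) := by
  have h : 0 ≤ (2 * (z * s1 - x * s2) - B * (s1 ^ 2 + s2 ^ 2) * s2) ^ 2 +
      (s1 ^ 2 + s2 ^ 2) * (2 * ((x + B * (s1 ^ 2 - s2 ^ 2)) ^ 2 +
        (z + B * (2 * s1 * s2)) ^ 2)) := by positivity
  rw [← sub_nonneg]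
  refine h.trans_eq ?_
  ring

lemma le_sq_sub {k θ μ s1 a b c X Φ : ℝ} (hk : 0 ≤ k) (hθ : θ * (k + 1) = 1)
    (hμ : μ = θ ^ 2 / 8) (hs1 : s1 ^ 2 ≤ Φ) :
    X ^ 2 * θ + 2 * (X * s1) - (2 * μ * X ^ 2 + Φ / 4) -
      3 / μ * (a ^ 2 + 16 * b ^ 2 + c ^ 2) ≤ (X + (k + 1) * s1 - (a + 4 * b + c)) ^ 2 := by
  have hθ0 : θ ≠ 0 := fun h => by simp [h] at hθ
  have hμ0 : 0 < μ := by rw [hμ]; positivity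
  have h6 : X ^ 2 * θ + 2 * (X * s1) ≤ (X + (k + 1) * s1) ^ 2 := by
    have h7 : (X + (k + 1) * s1) ^ 2 - 2 * (X * s1) - X ^ 2 * θ =
        ((k + 1) * s1 + k * θ * X) ^ 2 + k * θ ^ 2 * X ^ 2 := by
      linear_combination (-2 * k * X * s1 - X ^ 2 * (1 + k * θ)) * hθ
    have : 0 ≤ ((k + 1) * s1 + k * θ * X) ^ 2 + k * θ ^ 2 * X ^ 2 := by positivity
    linarith
  have h3 : μ * (X + (k + 1) * s1) ^ 2 ≤ 2 * μ * X ^ 2 + Φ / 4 := by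
    have h4 : μ * (k + 1) ^ 2 = 1 / 8 := by
      rw [hμ]; linear_combination (θ * (k + 1) + 1) / 8 * hθ
    have h5 : 2 * μ * X ^ 2 + s1 ^ 2 / 4 - μ * (X + (k + 1) * s1) ^ 2 =
        μ * (X - (k + 1) * s1) ^ 2 := by
      linear_combination -2 * s1 ^ 2 * h4
    have : 0 ≤ μ * (X - (k + 1) * s1) ^ 2 := by positivity
    linarith
  generalize X + (k + 1) * s1 = V at h6 h3 ⊢
  have h8 : V ^ 2 - μ * V ^ 2 - (a + 4 * b + c) ^ 2 / μ ≤ (V - (a + 4 * b + c)) ^ 2 := by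
    generalize a + 4 * b + c = ζ
    have h9 : (V - ζ) ^ 2 - (V ^ 2 - μ * V ^ 2 - ζ ^ 2 / μ) =
        μ * (V - ζ / μ) ^ 2 + ζ ^ 2 := by field_simp; ring
    have : 0 ≤ μ * (V - ζ / μ) ^ 2 + ζ ^ 2 := by positivity
    linarith
  have h10 : (a + 4 * b + c) ^ 2 / μ ≤ 3 / μ * (a ^ 2 + 16 * b ^ 2 + c ^ 2) := by
    rw [div_mul_eq_mul_div]
    gcongr
    linarith [sq_nonneg (a - 4 * b), sq_nonneg (a - c), sq_nonneg (4 * b - c)]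
  linarith

lemma div_mul_sq_add_le {B N M μ r X Φ ν Wsq K1 c : ℝ} (hμ : 0 < μ) (hN : 0 ≤ N) (hM : 0 ≤ M)
    (hNμ : N ≤ μ / 100) (hr : 0 ≤ r) (hrμ : r ≤ μ / 100) (hΦ : 0 ≤ Φ) (hν : 0 ≤ ν)
    (hW : 0 ≤ Wsq)
    (hK1 : K1 ^ 2 ≤ 12 * (N * (M * ν)) + 6 * (N ^ 2 * B ^ 2 * Φ) + 2 * (N ^ 2 * Wsq)) :
    3 / μ * (K1 ^ 2 + 16 * (X * r) ^ 2 + c) ≤ 36 / 100 * (M * ν) +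
      18 / 100 * (N * B ^ 2 * Φ) + 6 / 100 * (N * Wsq) + 48 / 100 * (r * X ^ 2) +
      3 / μ * c := by
  have e : 3 / μ * (K1 ^ 2 + 16 * (X * r) ^ 2 + c) =
      3 / μ * K1 ^ 2 + 48 * (r / μ) * (r * X ^ 2) + 3 / μ * c := by field_simp; ring
  have h1 : 3 / μ * K1 ^ 2 ≤ 3 / μ *
      (12 * (N * (M * ν)) + 6 * (N ^ 2 * B ^ 2 * Φ) + 2 * (N ^ 2 * Wsq)) := by gcongr
  have h2 : 3 / μ * (12 * (N * (M * ν)) + 6 * (N ^ 2 * B ^ 2 * Φ) + 2 * (N ^ 2 * Wsq)) =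
      N / μ * (36 * (M * ν) + 18 * (N * B ^ 2 * Φ) + 6 * (N * Wsq)) := by field_simp; ring
  have h3 : N / μ ≤ 1 / 100 := by rw [div_le_iff₀ hμ]; linarith
  have h4 : r / μ ≤ 1 / 100 := by rw [div_le_iff₀ hμ]; linarith
  have h5 := mul_le_mul_of_nonneg_right h3
    (show 0 ≤ 36 * (M * ν) + 18 * (N * B ^ 2 * Φ) + 6 * (N * Wsq) by positivity)
  have h6 := mul_le_mul_of_nonneg_right h4 (show 0 ≤ r * X ^ 2 by positivity)
  linarith

/-- The bound on the weighted gradient `X` that the second order condition at a maximum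
provides, once all terms have been expressed through an adapted frame. -/
lemma sq_le_of_max_condition {B α k θ μ E N M K r a g i L X Φ T s1 x ν Wsq ΔW K1 ξ : ℝ}
    (hB : 1 ≤ B) (hα : 1 ≤ α) (hk : 0 ≤ k) (hθ : θ * (k + 1) = 1) (hμ : μ = θ ^ 2 / 8)
    (hE : 2 * B + 2 ≤ E) (hN : 0 ≤ N) (hNμ : N * (B ^ 2 + α ^ 2) ≤ μ / 100) (hM : 0 < M)
    (hK : 0 ≤ K) (hKN : K ≤ N) (hr : 0 ≤ r) (hrμ : r ≤ μ / 100) (ha : 0 ≤ a) (hi : 0 ≤ i)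
    (hig : i ≤ g) (hT : 0 ≤ T) (hs1 : s1 ^ 2 ≤ Φ) (hx : x ^ 2 ≤ ν) (hW0 : 0 ≤ Wsq)
    (hWsq : Wsq ≤ 3 * (X ^ 2 + α ^ 2 * Φ + α ^ 2 * T))
    (hΔW : E * (Φ + T) - 2 * g - 2 * (X * s1) - 2 * (r * X ^ 2) - 2 * a ≤ ΔW)
    (hK1 : K1 ^ 2 ≤ 12 * (N * (M * ν)) + 6 * (N ^ 2 * B ^ 2 * Φ) + 2 * (N ^ 2 * Wsq))
    (hξ : ξ ^ 2 ≤ L ^ 2 * g ^ 2)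
    (h : (M * ν - N * Wsq + K * ΔW) + ΔW + 8 * (s1 * X * r) + 4 * x - 2 * B * Φ +
      (X + (k + 1) * s1 - (K1 + 4 * (X * r) + ξ)) ^ 2 - 4 * i ^ 2 - 4 * (s1 * i) ≤ 0) :
    θ / 2 * X ^ 2 ≤ 8 / M + (1 + N) * (2 * g + 2 * a) + 12 * g ^ 2 +
      3 / μ * (L ^ 2 * g ^ 2) := by
  have hθ0 : 0 < θ := by
    rw [eq_one_div_of_mul_eq_one_left hθ]; positivity
  have hθ1 : θ ≤ 1 := by linarith [mul_nonneg hθ0.le hk]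
  have hμ0 : 0 < μ := by rw [hμ]; positivity
  have hμθ : μ ≤ θ / 8 := by
    rw [hμ]; linarith [mul_le_mul_of_nonneg_left hθ1 hθ0.le]
  have hg : 0 ≤ g := hi.trans hig
  have hΦ : 0 ≤ Φ := (sq_nonneg _).trans hs1
  have hν : 0 ≤ ν := (sq_nonneg _).trans hx
  have hX2 := sq_nonneg X
  have hB2 : 1 ≤ B ^ 2 := one_le_pow₀ hB
  have hα2 : 1 ≤ α ^ 2 := one_le_pow₀ hα
  have hNB : N * B ^ 2 ≤ μ / 100 :=
    (mul_le_mul_of_nonneg_left (by linarith) hN).trans hNμ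
  have hNα : N * α ^ 2 ≤ μ / 100 :=
    (mul_le_mul_of_nonneg_left (by linarith) hN).trans hNμ
  have hN1 : N ≤ μ / 100 := (le_mul_of_one_le_right hN hB2).trans hNB
  have hXs : 2 * (X * s1) ≤ X ^ 2 + Φ := by linarith [sq_nonneg (X - s1)]
  have hXs' : -(X ^ 2 + Φ) ≤ 2 * (X * s1) := by linarith [sq_nonneg (X + s1)]
  have hEp : 0 ≤ E * (Φ + T) := by have : 0 ≤ E := by linarith
                                   positivity
  -- the individual terms
  have ta : -(N * (2 * g + X ^ 2 + Φ + 2 * (r * X ^ 2) + 2 * a)) ≤ K * ΔW := by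
    have hY : 0 ≤ 2 * g + X ^ 2 + Φ + 2 * (r * X ^ 2) + 2 * a := by positivity
    have h1 : K * -(2 * g + X ^ 2 + Φ + 2 * (r * X ^ 2) + 2 * a) ≤ K * ΔW :=
      mul_le_mul_of_nonneg_left (by linarith) hK
    have h2 := mul_le_mul_of_nonneg_right hKN hY
    linarith
  have tb : -(4 * (r * X ^ 2 + r * Φ)) ≤ 8 * (s1 * X * r) := by
    have := mul_le_mul_of_nonneg_left hXs' hr
    linarith
  have tc : -(M * ν / 2) - 8 / M ≤ 4 * x := by
    have h1 : 0 ≤ M / 2 * (x + 4 / M) ^ 2 := by positivity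
    have h2 : M / 2 * (x + 4 / M) ^ 2 = M * x ^ 2 / 2 + 4 * x + 8 / M := by field_simp; ring
    have h3 := mul_le_mul_of_nonneg_left hx hM.le
    linarith
  have td : -(12 * g ^ 2) - Φ / 2 ≤ -(4 * i ^ 2) - 4 * (s1 * i) := by
    have h1 : i ^ 2 ≤ g ^ 2 := pow_le_pow_left₀ hi hig 2
    linarith [sq_nonneg (s1 - 4 * i)]
  have te := le_sq_sub (s1 := s1) (a := K1) (b := X * r) (c := ξ) (X := X) (Φ := Φ) hk hθ hμ hs1
  have tf := div_mul_sq_add_le (X := X) (c := ξ ^ 2) hμ0 hN hM.le hN1 hr hrμ hΦ hν hW0 hK1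
  have tg : 3 / μ * ξ ^ 2 ≤ 3 / μ * (L ^ 2 * g ^ 2) := by gcongr
  have p1 : N * Wsq ≤ 3 * (μ / 100 * X ^ 2 + μ / 100 * Φ + μ / 100 * T) := by
    have q1 := mul_le_mul_of_nonneg_left hWsq hN
    have q2 := mul_le_mul_of_nonneg_right hN1 hX2
    have q3 := mul_le_mul_of_nonneg_right hNα hΦ
    have q4 := mul_le_mul_of_nonneg_right hNα hT
    linarith
  have p2 := mul_le_mul_of_nonneg_right hNB hΦ
  have p3 := mul_le_mul_of_nonneg_right hN1 hX2
  have p4 := mul_le_mul_of_nonneg_right hN1 hΦ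
  have p5 := mul_le_mul_of_nonneg_right hrμ hX2
  have p6 := mul_le_mul_of_nonneg_right hrμ hΦ
  have hN2 : N ≤ 1 := by linarith
  have p7 : N * (r * X ^ 2) ≤ r * X ^ 2 := mul_le_of_le_one_left (by positivity) hN2
  have p8 := mul_le_mul_of_nonneg_right hμθ hX2
  have hμ1 : μ ≤ 1 / 8 := by linarith
  have p9 := mul_le_mul_of_nonneg_right hμ1 hΦ
  have p10 := mul_le_mul_of_nonneg_right hμ1 hT
  have p11 := mul_le_mul_of_nonneg_right hE hΦ
  have p12 := mul_le_mul_of_nonneg_right hE hT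
  have p13 := mul_le_mul_of_nonneg_right hB hT
  have p14 : 0 ≤ M * ν := by positivity
  have p15 : 0 ≤ θ * X ^ 2 := by positivity
  have p16 : 0 ≤ μ * Φ := by positivity
  linarith

lemma quadratic_lower_bound {B η : ℝ} (hη : η < B) (h : 1 ≤ (B - η) * (1 - η)) (a b : ℝ) :
    η * (a ^ 2 + b ^ 2) ≤ B * a ^ 2 + 2 * (a * b) + b ^ 2 := by
  have h1 : (B - η) * (B * a ^ 2 + 2 * (a * b) + b ^ 2 - η * (a ^ 2 + b ^ 2)) =
      ((B - η) * a + b) ^ 2 + ((B - η) * (1 - η) - 1) * b ^ 2 := by ring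
  have h2 : 0 ≤ ((B - η) * (1 - η) - 1) * b ^ 2 := mul_nonneg (by linarith) (sq_nonneg _)
  have h3 : 0 ≤ (B - η) * (B * a ^ 2 + 2 * (a * b) + b ^ 2 - η * (a ^ 2 + b ^ 2)) := by
    rw [h1]; positivity
  linarith [nonneg_of_mul_nonneg_right h3 (sub_pos.2 hη)]

/-- The first and second order conditions at a maximum point of `exp(E) ‖grad f‖²`. -/
lemma PointJets.max_condition {B : ℝ} {f φ : (Fin 2 → ℝ) → ℝ} {p v w : Fin 2 → ℝ}
    (J : PointJets B f p v w) (hy : 0 < J.y) {E1 E2 E11 E22 : ℝ}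
    (hv : TwoJet (fun t => φ (p + t • v)) E1 E11) (hw : TwoJet (fun t => φ (p + t • w)) E2 E22)
    (hmax : IsLocalMax (fun x => Real.exp (φ x) * gradSq f f x) p) :
    E1 = J.t0 - 2 * J.y⁻¹ ∧ E11 + E22 + 2 * (J.s1 * E1 + J.s2 * E2) + 4 * J.x -
      2 * B * (J.s1 ^ 2 + J.s2 ^ 2) + (J.t2 - 2 * J.y⁻¹) ^ 2 - 4 * J.y⁻¹ ^ 2 -
      4 * (J.s1 * J.y⁻¹) ≤ 0 := by
  obtain ⟨a1, a2⟩ := hv.exp_mul_of_isLocalMax J.Ψv (hmax.line v)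
  obtain ⟨b1, b2⟩ := hw.exp_mul_of_isLocalMax J.Ψw (hmax.line w)
  simp only [zero_smul, add_zero, J.Ψ_eq] at a1 a2 b1 b2
  have hi : J.y⁻¹ * J.y = 1 := inv_mul_cancel₀ hy.ne'
  have e1 : E1 = J.t0 - 2 * J.y⁻¹ := by
    linear_combination J.y⁻¹ ^ 2 * a1 -
      ((E1 - J.t0) * (J.y⁻¹ * J.y + 1) + 2 * J.y⁻¹) * hi
  have e2 : E2 = J.t1 := by
    linear_combination J.y⁻¹ ^ 2 * b1 - (E2 - J.t1) * (J.y⁻¹ * J.y + 1) * hi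
  refine ⟨e1, ?_⟩
  have hs := mul_nonneg (sq_nonneg J.y⁻¹) (neg_nonneg.2 (add_nonpos a2 b2))
  have e4 : E1 ^ 2 + E11 + (E2 ^ 2 + E22) + J.y⁻¹ ^ 2 * (2 * E1 * (2 * J.y - J.t0 * J.y ^ 2)) -
      2 * E2 * J.t1 + J.y⁻¹ ^ 2 * (4 + 8 * J.y * J.s1) + 4 * J.s11 +
      (J.t0 ^ 2 + 2 * J.t1 ^ 2 + J.t2 ^ 2) ≤ 0 := by
    have e5 : J.y⁻¹ ^ 2 * J.y ^ 2 = 1 := by rw [← mul_pow, hi, one_pow]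
    have := J.tr_Ψ
    have e6 : J.q22 = 4 + 8 * J.y * J.s1 + 4 * J.s11 * J.y ^ 2 +
      J.y ^ 2 * (J.t0 ^ 2 + 2 * J.t1 ^ 2 + J.t2 ^ 2) - J.q11 := by linear_combination this
    rw [e6] at hs
    refine le_of_sub_nonneg (hs.trans_eq ?_)
    linear_combination -(E1 ^ 2 + E11 + E2 ^ 2 + E22 - 2 * E2 * J.t1 + 4 * J.s11 +
      (J.t0 ^ 2 + 2 * J.t1 ^ 2 + J.t2 ^ 2)) * e5
  have e7 : J.y⁻¹ ^ 2 * (2 * J.y - J.t0 * J.y ^ 2) = -E1 := by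
    rw [e1]; linear_combination (2 * J.y⁻¹ - J.t0 * (J.y⁻¹ * J.y + 1)) * hi
  have e8 : J.y⁻¹ ^ 2 * (J.y * J.s1) = J.y⁻¹ * J.s1 := by
    linear_combination (J.y⁻¹ * J.s1) * hi
  refine (sub_nonneg.1 ((sq_nonneg J.t1).trans_eq ?_)).trans e4
  have e9 : J.y⁻¹ ^ 2 * (2 * E1 * (2 * J.y - J.t0 * J.y ^ 2)) = -2 * E1 ^ 2 := by
    linear_combination 2 * E1 * e7
  rw [J.s11_eq, e9, e2, e1]
  linear_combination (-8) * e8 - 4 * J.y⁻¹ * J.tr_t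

/-- The test function whose maximum points give the gradient estimate. -/
noncomputable def testExponent (C m α d M₀ : ℝ) (f : (Fin 2 → ℝ) → ℝ) (x : Fin 2 → ℝ) : ℝ :=
  M₀ * (Real.exp (logWeight C m α d f x) * Phi f x) + logWeight C m α d f x -
    4 * Real.log (C - f x)

/-- The estimate of `‖grad f‖²` at a maximum point of the test function. -/
lemma PointJets.sq_le_of_isLocalMax {B C m α d M₀ : ℝ} {f : (Fin 2 → ℝ) → ℝ}
    {p v w : Fin 2 → ℝ} (J : PointJets B f p v w) {η θ μ N δ κ : ℝ} (hB : 1 ≤ B)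
    (hη : η < B) (hη' : 1 ≤ (B - η) * (1 - η)) (hα : 5 ≤ α) (hαη : 2 * B + 2 ≤ α * η)
    (hθ : θ * (α - 4) = 1) (hμ : μ = θ ^ 2 / 8) (hN : 0 ≤ N)
    (hNμ : N * (B ^ 2 + α ^ 2) ≤ μ / 100) (hm : 0 < m) (hs : 0 < C - f p)
    (hmμ : (C - f p) / m ≤ μ / 100) (hδ : 0 < δ) (hD : δ ≤ d + legVal f p) (hκ : 0 ≤ κ)
    (hUκ : |legVal f p + f p| ≤ κ * (d + legVal f p)) (hM₀ : 0 < M₀)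
    (hKN : M₀ * (Real.exp (logWeight C m α d f p) * Phi f p) ≤ N)
    (hX : 1 ≤ m / (C - f p) ^ 2 * J.y)
    (hmax : IsLocalMax (fun x => Real.exp (testExponent C m α d M₀ f x) * gradSq f f x) p) :
    θ / 2 * (m / (C - f p) ^ 2 * J.y) ^ 2 ≤
      8 / (M₀ * Real.exp (logWeight C m α d f p)) +
      (1 + N) * (2 * (m / (C - f p) ^ 2) + 2 * (α / δ)) + 12 * (m / (C - f p) ^ 2) ^ 2 +
      3 / μ * ((α * κ + 4) ^ 2 * (m / (C - f p) ^ 2) ^ 2) := by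
  have hD0 : 0 < d + legVal f p := hδ.trans_le hD
  obtain ⟨W1, W2, W11, W22, τ1, τ2, hv, hw, hW1, hW2, hτ, hΔ⟩ :=
    J.exists_logWeight (m := m) (α := α) hs hD0
  have hs' : 0 < C + -1 * f p := by linarith
  have E : ∀ (e : Fin 2 → ℝ) (a b a' b' a'' b'' : ℝ),
      TwoJet (fun t => f (p + t • e)) a b →
      TwoJet (fun t => logWeight C m α d f (p + t • e)) a' b' →
      TwoJet (fun t => Phi f (p + t • e)) a'' b'' →
      TwoJet (fun t => testExponent C m α d M₀ f (p + t • e))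
        (M₀ * Real.exp (logWeight C m α d f p) * (a' * Phi f p + a'') + a' + 4 * (a / (C - f p)))
        (M₀ * Real.exp (logWeight C m α d f p) * ((a' ^ 2 + b') * Phi f p + 2 * a' * a'' + b'') +
          b' + 4 * (b / (C - f p) + (a / (C - f p)) ^ 2)) := by
    intro e a b a' b' a'' b'' h1 h2 h3
    have k1 := (((h1.const_mul (-1)).const_add C).log (by simpa using hs)).const_mul 4
    have k2 := (h2.exp.mul h3).const_mul M₀
    simp only [zero_smul, add_zero] at k1 k2
    convert (k2.add h2).sub k1 using 1
    · ext t; simp only [testExponent]; ring_nf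
    · rw [show C + -1 * f p = C - f p by ring]; ring
    · rw [show C + -1 * f p = C - f p by ring]; ring
  have hy : 0 < J.y := J.y_nonneg.lt_of_ne fun h => by rw [← h] at hX; norm_num at hX
  obtain ⟨c1, c2⟩ := J.max_condition hy (E v _ _ _ _ _ _ J.fv hv J.Φv)
    (E w _ _ _ _ _ _ J.fw hw J.Φw) hmax
  have hP1 := J.P1_eq
  have hP2 := J.P2_eq
  have hT := J.tr_Φ
  have htr := J.tr_t
  have hΦ := J.Φ_eq
  have hΨ0 := J.y_nonneg
  have hi : J.y⁻¹ * J.y = 1 := inv_mul_cancel₀ hy.ne'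
  set M := M₀ * Real.exp (logWeight C m α d f p) with hM
  have hM0 : 0 < M := by positivity
  rw [← mul_assoc, ← hM] at hKN
  generalize Phi f p = Φ at *
  generalize J.P1 = P1 at *
  generalize J.P2 = P2 at *
  generalize J.s1 = s1 at *
  generalize J.s2 = s2 at *
  generalize J.x = x at *
  generalize J.z = z at *
  generalize J.y = y at *
  generalize J.t0 = t0 at *
  generalize J.t2 = t2 at *
  generalize J.p11 = p11 at *
  generalize J.p22 = p22 at *
  rw [← hΦ] at hT hP1 hP2 c2 hΔ
  have hΦ0 : 0 ≤ Φ := by rw [hΦ]; positivity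
  have hXr : m / (C - f p) ^ 2 * y * ((C - f p) / m) = y / (C - f p) := by field_simp
  have hrX : 2 * (C - f p) / m * (m / (C - f p) ^ 2 * y) ^ 2 =
      2 * ((C - f p) / m * (m / (C - f p) ^ 2 * y) ^ 2) := by ring
  have hr0 : 0 ≤ (C - f p) / m := by positivity
  have hg0 : 0 < m / (C - f p) ^ 2 := by positivity
  have hig : y⁻¹ ≤ m / (C - f p) ^ 2 := by rw [inv_le_iff_one_le_mul₀ hy]; exact hX
  rw [hrX] at hΔ
  have hτ1 : |τ1| ≤ κ * y⁻¹ := by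
    have h1 : |τ1| * y * (d + legVal f p) ≤ κ * (d + legVal f p) := by
      rw [← abs_of_pos hy, ← abs_of_pos hD0, ← abs_mul, ← abs_mul, hτ, abs_of_pos hD0]
      exact hUκ
    rw [← div_eq_mul_inv, le_div_iff₀ hy]
    exact le_of_mul_le_mul_right h1 hD0
  have hdiv : 2 * α / (d + legVal f p) ≤ 2 * (α / δ) := by
    rw [mul_div_assoc]
    gcongr
  have hα0 : 0 ≤ α := by linarith
  have hK0 : 0 ≤ M * Φ := by positivity
  have hbo := le_weighted_bochner hB s1 s2 x z W1 W2
  have hP1sq := sq_first_deriv_le B s1 s2 x z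
  rw [← hΦ] at hbo hP1sq
  rw [← hP1, ← hP2] at hbo
  rw [← hP1] at hP1sq
  have hy' : y / (C - f p) = m / (C - f p) ^ 2 * y * ((C - f p) / m) := hXr.symm
  rw [hy'] at c1 c2
  set X := m / (C - f p) ^ 2 * y
  set g := m / (C - f p) ^ 2
  set r := (C - f p) / m
  refine sq_le_of_max_condition (B := B) (α := α) (k := α - 5) (E := α * η) (K := M * Φ)
    (r := r) (i := y⁻¹) (Φ := Φ) (T := τ1 ^ 2 + τ2 ^ 2) (s1 := s1) (x := x)
    (ν := x ^ 2 + z ^ 2) (Wsq := W1 ^ 2 + W2 ^ 2)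
    (ΔW := W11 + W22 + 2 * (s1 * W1 + s2 * W2)) (K1 := M * (W1 * Φ + P1))
    (ξ := 4 * y⁻¹ - α * τ1) hB (by linarith) (by linarith)
    (by linear_combination hθ) hμ hαη hN hNμ hM0 hK0 hKN hr0 hmμ (by positivity) (by positivity)
    hig (by positivity) (by rw [hΦ]; linarith [sq_nonneg s2]) (by linarith [sq_nonneg z])
    (by positivity) ?_ ?_ ?_ ?_ ?_
  · have h1 : 0 ≤ (X - α * s1) ^ 2 + (X - α * τ1) ^ 2 + (α * s1 - α * τ1) ^ 2 +
        α ^ 2 * (s2 ^ 2 + τ2 ^ 2) + (α * s2 - α * τ2) ^ 2 := by positivity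
    rw [hΦ, hW1, hW2, ← sub_nonneg]
    refine h1.trans_eq ?_
    ring
  · have h1 := mul_le_mul_of_nonneg_left (quadratic_lower_bound hη hη' s1 τ1) hα0
    have h2 := mul_le_mul_of_nonneg_left (quadratic_lower_bound hη hη' s2 τ2) hα0
    rw [hΔ, hΦ]
    linarith
  · have h1 : M * P1 ^ 2 ≤ M * (Φ * (6 * (x ^ 2 + z ^ 2) + 3 * B ^ 2 * Φ ^ 2)) := by gcongr
    have h2 : (M * (W1 * Φ + P1)) ^ 2 ≤ 2 * (M * Φ) ^ 2 * W1 ^ 2 + 2 * M * (M * P1 ^ 2) := by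
      linarith [sq_nonneg (M * (W1 * Φ - P1)),
        show (M * (W1 * Φ - P1)) ^ 2 + (M * (W1 * Φ + P1)) ^ 2 =
          2 * (M * Φ) ^ 2 * W1 ^ 2 + 2 * M * (M * P1 ^ 2) by ring]
    have h3 : 2 * M * (M * P1 ^ 2) ≤ 12 * ((M * Φ) * (M * (x ^ 2 + z ^ 2))) +
        6 * ((M * Φ) ^ 2 * B ^ 2 * Φ) := by
      have := mul_le_mul_of_nonneg_left h1 (by positivity : 0 ≤ 2 * M)
      linarith
    have h4 : (M * Φ) ^ 2 ≤ N ^ 2 := pow_le_pow_left₀ hK0 hKN 2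
    have h5 : (M * Φ) * (M * (x ^ 2 + z ^ 2)) ≤ N * (M * (x ^ 2 + z ^ 2)) := by gcongr
    have h6 : (M * Φ) ^ 2 * B ^ 2 * Φ ≤ N ^ 2 * B ^ 2 * Φ := by gcongr
    have h7 : (M * Φ) ^ 2 * W1 ^ 2 ≤ N ^ 2 * W1 ^ 2 := by gcongr
    have h8 : 0 ≤ N ^ 2 * W2 ^ 2 := by positivity
    linarith
  · have h1 : |4 * y⁻¹ - α * τ1| ≤ |(α * κ + 4) * g| := by
      rw [abs_of_nonneg (by positivity : 0 ≤ (α * κ + 4) * g)]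
      have h2 : |4 * y⁻¹ - α * τ1| ≤ 4 * y⁻¹ + α * |τ1| := by
        refine (abs_sub _ _).trans_eq ?_
        rw [abs_mul, abs_mul, abs_of_nonneg hα0, abs_of_pos (inv_pos.2 hy)]
        norm_num
      have h3 := mul_le_mul_of_nonneg_left hτ1 hα0
      have h4 : (α * κ + 4) * y⁻¹ ≤ (α * κ + 4) * g := by gcongr
      linarith
    rw [← mul_pow]
    exact sq_le_sq.2 h1
  · have h1 : t2 - 2 * y⁻¹ = X + (α - 5 + 1) * s1 -
        (M * (W1 * Φ + P1) + 4 * (X * r) + (4 * y⁻¹ - α * τ1)) := by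
      rw [hW1] at c1 ⊢
      linear_combination htr + c1
    rw [← h1]
    have h2 := mul_le_mul_of_nonneg_left (hbo.trans (add_le_add_left
      (add_le_add_left hT _) _)) hM0.le
    have h3 : M * Φ * (W1 ^ 2 + W2 ^ 2) ≤ N * (W1 ^ 2 + W2 ^ 2) := by gcongr
    have h4 : 0 ≤ 1 / (C - f p) := by positivity
    have h5 := sq_nonneg (X * r)
    simp only [zero_div] at c2
    linarith

lemma exp_neg_div_mul_sq_le {m s s' : ℝ} (hs : 0 < s) (hss : s ≤ s') (hm : 4 * s' ≤ m) :
    Real.exp (-(m * s⁻¹)) * (m / s ^ 2) ^ 2 ≤ Real.exp (-(m * s'⁻¹)) * (m / s' ^ 2) ^ 2 := by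
  have hs' : 0 < s' := hs.trans_le hss
  have h1 : (s' / s) ^ 4 ≤ Real.exp (m * s⁻¹ - m * s'⁻¹) := by
    have h2 : s' / s ≤ Real.exp (s' / s - 1) := by linarith [Real.add_one_le_exp (s' / s - 1)]
    calc (s' / s) ^ 4 ≤ Real.exp (s' / s - 1) ^ 4 := by gcongr
      _ = Real.exp (4 * (s' / s - 1)) := by rw [← Real.exp_nat_mul]; norm_num
      _ ≤ _ := by
        gcongr
        have e : m * s⁻¹ - m * s'⁻¹ - 4 * (s' / s - 1) =
            (m - 4 * s') * ((s' - s) / (s * s')) := by field_simp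
        have : 0 ≤ (m - 4 * s') * ((s' - s) / (s * s')) :=
          mul_nonneg (by linarith) (div_nonneg (by linarith) (by positivity))
        linarith
  have h2 : Real.exp (-(m * s'⁻¹)) = Real.exp (-(m * s⁻¹)) * Real.exp (m * s⁻¹ - m * s'⁻¹) := by
    rw [← Real.exp_add]; ring_nf
  rw [h2, mul_assoc]
  gcongr
  calc (m / s ^ 2) ^ 2 = (s' / s) ^ 4 * (m / s' ^ 2) ^ 2 := by field_simp
    _ ≤ _ := by gcongr

lemma exp_neg_div_mul_sq_le_const {m s : ℝ} (hs : 0 < s) (hm : 1 ≤ m) :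
    Real.exp (-(m * s⁻¹)) * (m / s ^ 2) ^ 2 ≤ 24 := by
  have h0 : 0 ≤ m * s⁻¹ := by positivity
  have h1 := Real.pow_div_factorial_le_exp (m * s⁻¹) h0 4
  have h2 : Real.exp (-(m * s⁻¹)) * Real.exp (m * s⁻¹) = 1 := by rw [← Real.exp_add]; simp
  have h3 : (m / s ^ 2) ^ 2 ≤ 24 * Real.exp (m * s⁻¹) := by
    have h4 : (m / s ^ 2) ^ 2 ≤ m ^ 2 * (m / s ^ 2) ^ 2 :=
      le_mul_of_one_le_left (by positivity) (one_le_pow₀ hm)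
    have h5 : m ^ 2 * (m / s ^ 2) ^ 2 = (m * s⁻¹) ^ 4 := by field_simp
    have h6 : ((4).factorial : ℝ) = 24 := by norm_num [Nat.factorial]
    rw [h6, div_le_iff₀ (by norm_num)] at h1
    linarith
  calc _ ≤ Real.exp (-(m * s⁻¹)) * (24 * Real.exp (m * s⁻¹)) := by gcongr
    _ = 24 := by linear_combination 24 * h2

lemma exp_logWeight (C m α d : ℝ) (f : (Fin 2 → ℝ) → ℝ) (x : Fin 2 → ℝ) :
    Real.exp (logWeight C m α d f x) = Real.exp (-(m * (C - f x)⁻¹)) *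
      Real.exp (-(α * logRho f x) - α * Real.log (d + legVal f x)) := by
  rw [← Real.exp_add, logWeight]; ring_nf

lemma exp_logWeight_le {C C' m α d : ℝ} {f : (Fin 2 → ℝ) → ℝ} {x : Fin 2 → ℝ} (hm : 0 ≤ m)
    (hx : f x < C') (hC : C' ≤ C) :
    Real.exp (logWeight C' m α d f x) ≤ Real.exp (logWeight C m α d f x) := by
  rw [exp_logWeight, exp_logWeight]
  gcongr

lemma exp_logWeight_mul_sq_le {C C' m α d : ℝ} {f : (Fin 2 → ℝ) → ℝ} {x : Fin 2 → ℝ}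
    (hx : f x < C') (hC : C' ≤ C) (hm : 4 * (C - f x) ≤ m) :
    Real.exp (logWeight C' m α d f x) * (m / (C' - f x) ^ 2) ^ 2 ≤
      Real.exp (logWeight C m α d f x) * (m / (C - f x) ^ 2) ^ 2 := by
  have := mul_le_mul_of_nonneg_right
    (exp_neg_div_mul_sq_le (s := C' - f x) (s' := C - f x) (m := m) (by linarith) (by linarith) hm)
    (Real.exp_pos (-(α * logRho f x) - α * Real.log (d + legVal f x))).le
  rw [exp_logWeight, exp_logWeight]
  linarith

/-- A continuous function that vanishes where `f ≥ C'` attains its maximum in `Ω`. -/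
lemma exists_isLocalMax {Ω : Set (Fin 2 → ℝ)} {C C' : ℝ} {f : (Fin 2 → ℝ) → ℝ}
    (hN : NormalizedDomain Ω) (hS : SClass Ω C f) (hC : C' < C) {ψ : ℝ → ℝ} (hψ : Continuous ψ)
    (hψ0 : ∀ t, C' ≤ t → ψ t = 0) {h k : (Fin 2 → ℝ) → ℝ} (hk : ContinuousOn k Ω)
    (hh : ∀ x ∈ Ω, f x < C' → h x = ψ (f x) * k x) {x₀ : Fin 2 → ℝ} (hx₀ : x₀ ∈ Ω)
    (hfx : f x₀ < C') (hpos : 0 < h x₀) :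
    ∃ p ∈ Ω, f p < C' ∧ 0 < h p ∧ IsLocalMax h p ∧ h x₀ ≤ h p := by
  have hcl := hS.2.2.2.1
  set S := closure Ω ∩ f ⁻¹' Set.Iic C' with hSdef
  have hScpt : IsCompact S := (isCompact_closure hN).of_isClosed_subset
    (hcl.preimage_isClosed_of_isClosed isClosed_closure isClosed_Iic) Set.inter_subset_left
  have hSΩ : S ⊆ Ω := fun x hx => by
    by_contra hx'
    have : x ∈ frontier Ω := by
      rw [frontier, hN.1.interior_eq]; exact ⟨hx.1, hx'⟩
    have h1 := hS.2.2.2.2 x this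
    have h2 : f x ≤ C' := hx.2
    linarith
  have hcont : ContinuousOn (fun x => ψ (f x) * k x) Ω :=
    (hψ.comp_continuousOn (hcl.mono subset_closure)).mul hk
  obtain ⟨p, hpS, hp⟩ := hScpt.exists_isMaxOn ⟨x₀, subset_closure hx₀, hfx.le⟩
    (hcont.mono hSΩ)
  have hx₀p : ψ (f x₀) * k x₀ ≤ ψ (f p) * k p := hp ⟨subset_closure hx₀, hfx.le⟩
  rw [← hh x₀ hx₀ hfx] at hx₀p
  have hpC : f p < C' := by
    by_contra! hge
    rw [hψ0 _ hge, zero_mul] at hx₀p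
    linarith
  have hpΩ := hSΩ hpS
  rw [← hh p hpΩ hpC] at hx₀p
  refine ⟨p, hpΩ, hpC, hpos.trans_le hx₀p, ?_, hx₀p⟩
  have hfc : ContinuousAt f p := (hcl.mono subset_closure).continuousAt (hN.1.mem_nhds hpΩ)
  filter_upwards [hN.1.mem_nhds hpΩ, hfc.eventually (gt_mem_nhds hpC)] with x hx hxC
  rw [hh x hx hxC, hh p hpΩ hpC]
  exact hp ⟨subset_closure hx, hxC.le⟩

section GlobalEstimates

variable {Ω : Set (Fin 2 → ℝ)} {C m α β d b δ : ℝ} {f : (Fin 2 → ℝ) → ℝ}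

lemma exp_logWeight_le_rpow (hS : SClass Ω C f) (hα : 0 ≤ α) {x : Fin 2 → ℝ} (hx : x ∈ Ω)
    (hpos : 0 < d + legVal f x) (hρ : 1 / (rho f x * (d + legVal f x)) < b) (C' : ℝ) :
    Real.exp (logWeight C' m α d f x) ≤ Real.exp (-(m * (C' - f x)⁻¹)) * b ^ α := by
  rw [exp_logWeight]
  gcongr
  have h0 : 0 < rho f x := by rw [rho_eq_exp hS.2.1 hx]; positivity
  have hb : 0 < 1 / (rho f x * (d + legVal f x)) := by positivity
  rw [Real.rpow_def_of_pos (hb.trans hρ)]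
  gcongr
  have h1 := Real.log_le_log hb hρ.le
  rw [one_div, Real.log_inv, Real.log_mul h0.ne' hpos.ne', rho_eq_exp hS.2.1 hx,
    Real.log_exp] at h1
  linarith [mul_le_mul_of_nonneg_right h1 hα]

/-- The elementary bounds on the weight. -/
lemma exp_logWeight_bounds (hS : SClass Ω C f) (hα : 0 ≤ α) {x : Fin 2 → ℝ} (hx : x ∈ Ω)
    (hpos : 0 < d + legVal f x) (hρ : 1 / (rho f x * (d + legVal f x)) < b) (hm : 1 ≤ m)
    {C' : ℝ} (hC' : f x < C') :
    Real.exp (logWeight C' m α d f x) ≤ b ^ α ∧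
    Real.exp (logWeight C' m α d f x) * (m / (C' - f x) ^ 2) ≤ 25 * b ^ α ∧
    Real.exp (logWeight C' m α d f x) * (m / (C' - f x) ^ 2) ^ 2 ≤ 24 * b ^ α := by
  have hs : 0 < C' - f x := by linarith
  have h1 := exp_logWeight_le_rpow (m := m) hS hα hx hpos hρ C'
  have hb : 0 < b := lt_trans (by
    have : 0 < rho f x := by rw [rho_eq_exp hS.2.1 hx]; positivity
    positivity) hρ
  have hbα : 0 < b ^ α := by positivity
  have h2 : Real.exp (-(m * (C' - f x)⁻¹)) ≤ 1 := by
    rw [Real.exp_le_one_iff, neg_nonpos]; positivity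
  have h3 := exp_neg_div_mul_sq_le_const hs hm
  have h4 : Real.exp (logWeight C' m α d f x) ≤ b ^ α :=
    h1.trans (mul_le_of_le_one_left hbα.le h2)
  have h5 : Real.exp (logWeight C' m α d f x) * (m / (C' - f x) ^ 2) ^ 2 ≤ 24 * b ^ α := by
    calc _ ≤ Real.exp (-(m * (C' - f x)⁻¹)) * b ^ α * (m / (C' - f x) ^ 2) ^ 2 := by gcongr
      _ = Real.exp (-(m * (C' - f x)⁻¹)) * (m / (C' - f x) ^ 2) ^ 2 * b ^ α := by ring
      _ ≤ _ := by gcongr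
  refine ⟨h4, ?_, h5⟩
  set g := m / (C' - f x) ^ 2
  have h6 : g ≤ 1 + g ^ 2 := by linarith [sq_nonneg (g - 1), sq_nonneg g]
  have h7 := mul_le_mul_of_nonneg_left h6 (Real.exp_pos (logWeight C' m α d f x)).le
  linarith

lemma le_of_forall_lt_weight {x : Fin 2 → ℝ} (hx : f x < C) {Y R : ℝ} {n : ℕ}
    (h : ∀ C', f x < C' → C' < C →
      Real.exp (logWeight C' m α d f x) * (m / (C' - f x) ^ 2) ^ n * Y ≤ R) :
    Real.exp (logWeight C m α d f x) * (m / (C - f x) ^ 2) ^ n * Y ≤ R := by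
  have h0 : C - f x ≠ 0 := by linarith
  have hc : ContinuousAt (fun C' => Real.exp (logWeight C' m α d f x) *
      (m / (C' - f x) ^ 2) ^ n * Y) C := by
    unfold logWeight
    have h1 : ContinuousAt (fun C' => C' - f x) C := by fun_prop
    have h2 := h1.inv₀ h0
    have h3 := (continuousAt_const (y := m)).div (h1.pow 2) (pow_ne_zero 2 h0)
    exact ((((((h2.const_mul m).neg).sub continuousAt_const).sub continuousAt_const).rexp).mul
      (h3.pow n)).mul continuousAt_const
  refine le_of_tendsto (hc.tendsto.mono_left (nhdsWithin_le_nhds (s := Set.Iio C))) ?_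
  filter_upwards [self_mem_nhdsWithin, nhdsWithin_le_nhds (lt_mem_nhds hx)] with C' h1 h2
  exact h C' h2 h1

end GlobalEstimates

section GradientEstimates

variable {Ω : Set (Fin 2 → ℝ)} {C m α β d b δ : ℝ} {f : (Fin 2 → ℝ) → ℝ}

lemma nonempty_pointJets (hN : NormalizedDomain Ω) (hS : SClass Ω C f) (hpde : PDE2 f β Ω)
    {p : Fin 2 → ℝ} (hp : p ∈ Ω) : ∃ v w, Nonempty (PointJets (β + 1) f p v w) := by
  obtain ⟨v, w, hF⟩ := exists_isAdaptedFrame hN.1 hS.1 hS.2.1 hp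
  exact ⟨v, w, exists_pointJets hN.1 hS.1 hS.2.1 hpde hp hF⟩

/-- The part of the weight `exp(-m/(C-f)) / (ρ (d+u))^α` that does not depend on `C`. -/
lemma continuousOn_weight (hN : NormalizedDomain Ω) (hS : SClass Ω C f)
    (hpos : ∀ x ∈ Ω, 0 < d + legVal f x) :
    ContinuousOn (fun x => Real.exp (-(α * logRho f x) - α * Real.log (d + legVal f x))) Ω := by
  have h1 := (logRho_contDiffOn hN.1 hS.1 hS.2.1).continuousOn
  have h2 := ((legVal_contDiffOn hN.1 hS.1).continuousOn.const_add d).log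
    fun x hx => (hpos x hx).ne'
  exact (((h1.const_smul α).neg).sub (h2.const_smul α)).rexp

lemma continuousOn_Phi (hN : NormalizedDomain Ω) (hS : SClass Ω C f) :
    ContinuousOn (Phi f) Ω :=
  (gradSq_contDiffOn hN.1 hS.1 hS.2.1 (logRho_contDiffOn hN.1 hS.1 hS.2.1)).continuousOn.congr
    fun _ hx => Phi_eq_gradSq hN.1 hS.1 hS.2.1 hx

lemma expNegInvGlue_eq {s : ℝ} (hm : 0 < m) (hs : 0 < s) :
    expNegInvGlue (s / m) = Real.exp (-(m * s⁻¹)) := by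
  rw [expNegInvGlue, if_neg (not_le.2 (by positivity)), inv_div, div_eq_mul_inv]

lemma continuous_cutoff (C m : ℝ) : Continuous fun t : ℝ => expNegInvGlue ((C - t) / m) :=
  (expNegInvGlue.contDiff (n := 0)).continuous.comp (by fun_prop)

/-- The estimate of `Φ` through an upper bound `R` for the weighted gradient of `f`. -/
lemma weighted_Phi_le (hN : NormalizedDomain Ω) (hS : SClass Ω C f) (hpde : PDE2 f β Ω)
    (hβ : 0 < β) (hα : 0 ≤ α) (hδ : 0 < δ) (hD : ∀ x ∈ Ω, δ ≤ d + legVal f x)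
    (hρ : ∀ x ∈ Ω, 1 / (rho f x * (d + legVal f x)) < b) (hm : 1 ≤ m) (hmC : 4 * C ≤ m) {R : ℝ}
    (hR : ∀ x ∈ Ω, Real.exp (logWeight C m α d f x) * (m / (C - f x) ^ 2) ^ 2 * gradSq f f x ≤ R)
    {x : Fin 2 → ℝ} (hx : x ∈ Ω) :
    α * β * (Real.exp (logWeight C m α d f x) * Phi f x) ≤
      2 * R + (50 + 2 * (α / δ)) * b ^ α := by
  have hpos : ∀ x ∈ Ω, 0 < d + legVal f x := fun x hx => hδ.trans_le (hD x hx)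
  have hm0 : 0 < m := by linarith
  have hb0 : ∀ x ∈ Ω, 0 < b := fun x hx => lt_trans (by
    have : 0 < rho f x := by rw [rho_eq_exp hS.2.1 hx]; positivity
    have := hpos x hx
    positivity) (hρ x hx)
  have hR0 : ∀ x ∈ Ω, 0 ≤ R := fun x hx => by
    obtain ⟨v, w, ⟨J⟩⟩ := nonempty_pointJets hN hS hpde hx
    refine le_trans ?_ (hR x hx)
    rw [J.Ψ_eq]
    positivity
  have key : ∀ C', f x < C' → C' < C →
      Real.exp (logWeight C' m α d f x) * (m / (C' - f x) ^ 2) ^ 0 * (α * β * Phi f x) ≤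
        2 * R + (50 + 2 * (α / δ)) * b ^ α := by
    intro C' hxC' hC'
    rw [pow_zero, mul_one]
    have hconst : 0 ≤ 2 * R + (50 + 2 * (α / δ)) * b ^ α := by
      have h1 := hR0 x hx
      have h2 := hb0 x hx
      positivity
    rcases le_or_gt (Phi f x) 0 with hΦ | hΦ
    · refine le_trans ?_ hconst
      have : 0 ≤ Real.exp (logWeight C' m α d f x) * (α * β * -Phi f x) := by
        have : 0 ≤ -Phi f x := by linarith
        positivity
      linarith
    obtain ⟨p, hp, hpC, hp0, hmax, hle⟩ := exists_isLocalMax hN hS hC'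
      (ψ := fun t => expNegInvGlue ((C' - t) / m))
      (h := fun x => Real.exp (logWeight C' m α d f x) * Phi f x)
      (k := fun x => Real.exp (-(α * logRho f x) - α * Real.log (d + legVal f x)) * Phi f x)
      (continuous_cutoff C' m)
      (fun t ht => expNegInvGlue.zero_of_nonpos
        (div_nonpos_of_nonpos_of_nonneg (by linarith) hm0.le))
      ((continuousOn_weight hN hS hpos).mul (continuousOn_Phi hN hS))
      (fun x _ hxC => by
        rw [expNegInvGlue_eq hm0 (by linarith), exp_logWeight]; ring) hx hxC' (by positivity)
    obtain ⟨v, w, ⟨J⟩⟩ := nonempty_pointJets hN hS hpde hp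
    have hs : 0 < C' - f p := by linarith
    have hA := J.phi_le_of_isLocalMax (m := m) (α := α) (d := d) (by linarith) hα hs
      (hpos p hp) (pos_of_mul_pos_right hp0 (Real.exp_pos _).le) hmax
    obtain ⟨e1, e2, -⟩ := exp_logWeight_bounds hS hα hp (hpos p hp) (hρ p hp) hm hpC
    have hf0 := nonneg_of_SClass hN hS hp
    have e3 := exp_logWeight_mul_sq_le (α := α) (d := d) (m := m) hpC hC'.le (by linarith)
    have e4 := hR p hp
    rw [J.Ψ_eq] at e4
    have e5 : 2 * α / (d + legVal f p) ≤ 2 * (α / δ) := by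
      rw [mul_div_assoc]
      gcongr
      exact hD p hp
    have e6 : 2 * (C' - f p) / m ≤ 1 := by rw [div_le_one hm0]; linarith
    set e := Real.exp (logWeight C' m α d f p) with he
    have he0 : 0 < e := Real.exp_pos _
    set g := m / (C' - f p) ^ 2 with hg
    have hX : (1 + 2 * (C' - f p) / m) * (g * J.y) ^ 2 ≤ 2 * (g * J.y) ^ 2 := by
      gcongr; linarith
    have h1 : e * (α * β * Phi f p) ≤ e * (2 * (g * J.y) ^ 2 + 2 * g + 2 * (α / δ)) := by
      gcongr
      rw [add_sub_cancel_right] at hA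
      linarith
    have h2 : e * (g * J.y) ^ 2 ≤ R := by
      refine le_trans ?_ e4
      have := mul_le_mul_of_nonneg_right e3 (sq_nonneg J.y)
      linarith
    have h3 : α * β * (Real.exp (logWeight C' m α d f x) * Phi f x) ≤
        α * β * (e * Phi f p) := by
      have : 0 ≤ α * β := by positivity
      gcongr
    have h4 : e * (2 * (α / δ)) ≤ b ^ α * (2 * (α / δ)) := by gcongr
    linarith
  have := le_of_forall_lt_weight ((lt_of_SClass hN hS hx)) key
  rw [pow_zero, mul_one] at this
  linarith

/-- Boundedness of the weighted gradient of `f`, provided that the weighted `Φ` is bounded. -/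
lemma exists_weighted_gradient_le (hN : NormalizedDomain Ω) (hS : SClass Ω C f)
    (hpde : PDE2 f β Ω) {η θ μ N A : ℝ} (hβ : 0 < β) (hη : η < β + 1)
    (hη' : 1 ≤ (β + 1 - η) * (1 - η)) (hα : 5 ≤ α) (hαη : 2 * (β + 1) + 2 ≤ α * η)
    (hθ : θ * (α - 4) = 1) (hμ : μ = θ ^ 2 / 8) (hN0 : 0 < N)
    (hNμ : N * ((β + 1) ^ 2 + α ^ 2) ≤ μ / 100) (hd : 0 < d) (hδ : 0 < δ)
    (hD : ∀ x ∈ Ω, δ ≤ d + legVal f x)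
    (hρ : ∀ x ∈ Ω, 1 / (rho f x * (d + legVal f x)) < b) (hm : 1 ≤ m)
    (hmμ : C / m ≤ μ / 100) (hA0 : 0 < A)
    (hA : ∀ x ∈ Ω, Real.exp (logWeight C m α d f x) * Phi f x ≤ A) :
    ∃ R, ∀ x ∈ Ω,
      Real.exp (logWeight C m α d f x) * (m / (C - f x) ^ 2) ^ 2 * gradSq f f x ≤ R := by
  have hpos : ∀ x ∈ Ω, 0 < d + legVal f x := fun x hx => hδ.trans_le (hD x hx)
  have hm0 : 0 < m := by linarith
  have hα0 : 0 ≤ α := by linarith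
  have hθ0 : 0 < θ := by
    rw [eq_one_div_of_mul_eq_one_left hθ]
    have : 0 < α - 4 := by linarith
    positivity
  have hμ0 : 0 < μ := by rw [hμ]; positivity
  have hb : 0 < b := lt_trans (by
    have h0 := hN.zero_mem
    have : 0 < rho f 0 := by rw [rho_eq_exp hS.2.1 h0]; positivity
    have := hpos 0 h0
    positivity) (hρ 0 (hN.zero_mem))
  have hC : 0 < C := (nonneg_of_SClass hN hS (hN.zero_mem)).trans_lt
    (lt_of_SClass hN hS (hN.zero_mem))
  have hbα : 0 < b ^ α := by positivity
  obtain ⟨κ, hκ0, hκ⟩ : ∃ κ : ℝ, 0 ≤ κ ∧ ∀ x ∈ Ω,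
      |legVal f x + f x| ≤ κ * (d + legVal f x) := by
    refine ⟨1 + (d + C) / δ, by positivity, fun x hx => ?_⟩
    have h1 := lt_of_SClass hN hS hx
    have h2 := nonneg_of_SClass hN hS hx
    have h3 := mul_le_mul_of_nonneg_left (hD x hx) (show 0 ≤ (d + C) / δ by positivity)
    rw [div_mul_cancel₀ _ hδ.ne'] at h3
    have h4 := hpos x hx
    rw [abs_le]
    constructor <;> linarith
  set M₀ := N / A with hM₀
  have hM₀0 : 0 < M₀ := by positivity
  set R₁ := 8 / M₀ + (1 + N) * (50 + 2 * (α / δ)) * b ^ α + 288 * b ^ α +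
    3 / μ * ((α * κ + 4) ^ 2 * (24 * b ^ α)) with hR₁
  have hR₁0 : 0 ≤ R₁ := by positivity
  have hmain : ∀ x ∈ Ω, ∀ C', f x < C' → C' < C →
      Real.exp (logWeight C' m α d f x) * (m / (C' - f x) ^ 2) ^ 2 * gradSq f f x ≤
        Real.exp N * (b ^ α + 2 / θ * R₁) := by
    intro x hx C' hxC' hC'
    rcases le_or_gt (gradSq f f x) 0 with hΨ | hΨ
    · have h1 : 0 ≤ Real.exp N * (b ^ α + 2 / θ * R₁) := by positivity
      have h2 : 0 ≤ Real.exp (logWeight C' m α d f x) * (m / (C' - f x) ^ 2) ^ 2 *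
          -gradSq f f x := by
        have : 0 ≤ -gradSq f f x := by linarith
        positivity
      linarith
    have hexp : ∀ x, f x < C' → Real.exp (testExponent C' m α d M₀ f x) =
        Real.exp (M₀ * (Real.exp (logWeight C' m α d f x) * Phi f x)) *
          Real.exp (logWeight C' m α d f x) * ((C' - f x)⁻¹) ^ 4 := by
      intro x hxC
      have hs : 0 < C' - f x := by linarith
      rw [testExponent, sub_eq_add_neg, Real.exp_add, Real.exp_add, ← mul_neg, ← Real.log_inv,
        show (4 : ℝ) = ((4 : ℕ) : ℝ) by norm_num, Real.exp_nat_mul,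
        Real.exp_log (inv_pos.2 hs)]
    have hglue4 : Continuous fun t => (((C' - t) / m)⁻¹) ^ 4 * expNegInvGlue ((C' - t) / m) := by
      have h1 := expNegInvGlue.continuous_polynomial_eval_inv_mul (Polynomial.X ^ 4)
      simp only [Polynomial.eval_pow, Polynomial.eval_X] at h1
      exact h1.comp (show Continuous fun t => (C' - t) / m by fun_prop)
    have hfc : ContinuousOn f Ω := hS.1.continuousOn
    have hwc := continuousOn_weight (α := α) hN hS hpos
    obtain ⟨p, hp, hpC, hp0, hmax, hle⟩ := exists_isLocalMax hN hS hC'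
      (h := fun x => Real.exp (testExponent C' m α d M₀ f x) * gradSq f f x)
      (k := fun x => Real.exp (M₀ * (expNegInvGlue ((C' - f x) / m) *
        Real.exp (-(α * logRho f x) - α * Real.log (d + legVal f x)) * Phi f x)) *
        Real.exp (-(α * logRho f x) - α * Real.log (d + legVal f x)) * gradSq f f x * (m⁻¹) ^ 4)
      hglue4
      (fun t ht => by
        rw [expNegInvGlue.zero_of_nonpos
          (div_nonpos_of_nonpos_of_nonneg (by linarith) hm0.le), mul_zero])
      ((((((((continuous_cutoff C' m).comp_continuousOn hfc).mul hwc).mul (continuousOn_Phi hN hS)).const_smul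
        M₀).rexp.mul hwc).mul (gradSq_contDiffOn hN.1 hS.1 hS.2.1 hS.1).continuousOn).mul
        continuousOn_const)
      (fun x _ hxC => by
        rw [hexp x hxC, expNegInvGlue_eq hm0 (by linarith), ← exp_logWeight, exp_logWeight]
        have hs : C' - f x ≠ 0 := by linarith
        field_simp) hx hxC' (by positivity)
    obtain ⟨v, w, ⟨J⟩⟩ := nonempty_pointJets hN hS hpde hp
    have hs : 0 < C' - f p := by linarith
    have hKN : ∀ q ∈ Ω, f q < C' →
        M₀ * (Real.exp (logWeight C' m α d f q) * Phi f q) ≤ N ∧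
        0 ≤ M₀ * (Real.exp (logWeight C' m α d f q) * Phi f q) := by
      intro q hq hqC
      obtain ⟨v, w, ⟨J⟩⟩ := nonempty_pointJets hN hS hpde hq
      have hΦ : 0 ≤ Phi f q := by rw [J.Φ_eq]; positivity
      refine ⟨?_, by positivity⟩
      calc _ ≤ M₀ * (Real.exp (logWeight C m α d f q) * Phi f q) := by
            gcongr ?_ * (?_ * _); exact exp_logWeight_le hm0.le hqC hC'.le
        _ ≤ M₀ * A := by gcongr; exact hA q hq
        _ = N := by rw [hM₀]; field_simp
    obtain ⟨e1, e2, e3⟩ := exp_logWeight_bounds hS hα0 hp (hpos p hp) (hρ p hp) hm hpC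
    have hf0 := nonneg_of_SClass hN hS hp
    have hbd : Real.exp (logWeight C' m α d f p) * (m / (C' - f p) ^ 2 * J.y) ^ 2 ≤
        b ^ α + 2 / θ * R₁ := by
      rcases le_or_gt 1 (m / (C' - f p) ^ 2 * J.y) with hX | hX
      · have hB := J.sq_le_of_isLocalMax (by linarith) hη hη' hα hαη hθ hμ hN0.le hNμ hm0 hs
          (le_trans (by gcongr; linarith) hmμ) hδ (hD p hp) hκ0 (hκ p hp) hM₀0
          (hKN p hp hpC).1 hX hmax
        set e := Real.exp (logWeight C' m α d f p)
        have he0 : 0 < e := Real.exp_pos _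
        set g := m / (C' - f p) ^ 2
        set X := g * J.y
        have h1 := mul_le_mul_of_nonneg_left hB he0.le
        have h2 : e * (8 / (M₀ * e)) = 8 / M₀ := by field_simp
        have h3 : (1 + N) * (2 * (e * g) + 2 * (α / δ) * e) ≤
            (1 + N) * (2 * (25 * b ^ α) + 2 * (α / δ) * b ^ α) := by gcongr
        have h4 : 3 / μ * ((α * κ + 4) ^ 2 * (e * g ^ 2)) ≤
            3 / μ * ((α * κ + 4) ^ 2 * (24 * b ^ α)) := by gcongr
        have h5 : θ / 2 * (e * X ^ 2) ≤ R₁ := by rw [hR₁]; linarith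
        have h6 : e * X ^ 2 ≤ 2 / θ * R₁ := by
          rw [div_mul_eq_mul_div, le_div_iff₀ hθ0]; linarith
        linarith
      · have hX0 : 0 ≤ m / (C' - f p) ^ 2 * J.y := by
          have := J.y_nonneg
          positivity
        have h1 : (m / (C' - f p) ^ 2 * J.y) ^ 2 ≤ 1 := pow_le_one₀ hX0 hX.le
        have h2 := mul_le_mul_of_nonneg_left h1 (Real.exp_pos (logWeight C' m α d f p)).le
        have h3 : 0 ≤ 2 / θ * R₁ := by positivity
        linarith
    have hconv : ∀ q, f q < C' → m ^ 2 * (Real.exp (testExponent C' m α d M₀ f q) *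
        gradSq f f q) = Real.exp (M₀ * (Real.exp (logWeight C' m α d f q) * Phi f q)) *
          (Real.exp (logWeight C' m α d f q) * (m / (C' - f q) ^ 2) ^ 2 * gradSq f f q) := by
      intro q hq
      have hs : C' - f q ≠ 0 := by linarith
      rw [hexp q hq]
      field_simp
    have h1 := mul_le_mul_of_nonneg_left hle (sq_nonneg m)
    rw [hconv x hxC', hconv p hpC, J.Ψ_eq] at h1
    have h2 : Real.exp (M₀ * (Real.exp (logWeight C' m α d f p) * Phi f p)) ≤ Real.exp N :=
      Real.exp_le_exp.2 (hKN p hp hpC).1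
    have h3 : 1 ≤ Real.exp (M₀ * (Real.exp (logWeight C' m α d f x) * Phi f x)) :=
      Real.one_le_exp (hKN x hx hxC').2
    calc _ ≤ Real.exp (M₀ * (Real.exp (logWeight C' m α d f x) * Phi f x)) *
          (Real.exp (logWeight C' m α d f x) * (m / (C' - f x) ^ 2) ^ 2 * gradSq f f x) :=
          le_mul_of_one_le_left (by positivity) h3
      _ ≤ _ := h1
      _ = Real.exp (M₀ * (Real.exp (logWeight C' m α d f p) * Phi f p)) *
          (Real.exp (logWeight C' m α d f p) * (m / (C' - f p) ^ 2 * J.y) ^ 2) := by ring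
      _ ≤ _ := by gcongr
  exact ⟨_, fun x hx => le_of_forall_lt_weight (lt_of_SClass hN hS hx) (hmain x hx)⟩

end GradientEstimates

lemma exp_logWeight_eq {Ω : Set (Fin 2 → ℝ)} {C : ℝ} {f u : (Fin 2 → ℝ) → ℝ}
    (hS : SClass Ω C f) (hu : LegendreOf Ω f u) (m α d : ℝ) {x : Fin 2 → ℝ} (hx : x ∈ Ω)
    (hpos : 0 < d + u (gradv f x)) :
    Real.exp (logWeight C m α d f x) = Real.exp (-m / (C - f x)) /
      ((rho f x) ^ α * (d + u (gradv f x)) ^ α) := by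
  rw [Real.rpow_def_of_pos hpos, hu.eq_legVal hx, rho_eq_exp hS.2.1 hx, ← Real.exp_mul,
    ← Real.exp_add, ← Real.exp_sub, logWeight]
  congr 1
  ring

/-- Lemma 3.4: with `f ∈ 𝒮(Ω,C)` solving PDE (1.2), `β > 0`, and
`1/(ρ(d+u)) < b` on `Ω`, there are positive constants `α, N, m` such that
`𝒜 ≤ max{d₁, (4/(αβ))𝒟}`, `d₁` depending only on `α, C, b, β` (and `d`). -/
theorem statement10 (C β b d : ℝ) (hC : 0 < C) (hβ : 0 < β) (hb : 0 < b) (hd : 0 < d) :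
    ∃ α N m : ℝ, 0 < α ∧ 0 < N ∧ 0 < m ∧
      ∃ d₁ : ℝ, 0 < d₁ ∧
        ∀ (Ω : Set (Fin 2 → ℝ)) (f u : (Fin 2 → ℝ) → ℝ),
          NormalizedDomain Ω → SClass Ω C f → PDE2 f β Ω → LegendreOf Ω f u →
          (∀ x ∈ Ω, 0 < d + u (gradv f x)) →
          (∀ x ∈ Ω, 1 / (rho f x * (d + u (gradv f x))) < b) →
          Aval Ω C m α d f u ≤ max d₁ (4 / (α * β) * Dval Ω C m α N d f u) := by
  have hη1 : β / (2 + β) < β + 1 := by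
    rw [div_lt_iff₀ (by positivity)]; linarith [mul_pos hβ hβ]
  have hη2 : 1 ≤ (β + 1 - β / (2 + β)) * (1 - β / (2 + β)) := by
    have : (β + 1 - β / (2 + β)) * (1 - β / (2 + β)) = 1 + (β / (2 + β)) ^ 2 := by
      field_simp; ring
    rw [this]; linarith [sq_nonneg (β / (2 + β))]
  have hη0 : 0 < β / (2 + β) := by positivity
  set η := β / (2 + β)
  set α := 5 + (2 * (β + 1) + 2) / η with hα
  have hα5 : 5 ≤ α := by rw [hα]; linarith [show 0 < (2 * (β + 1) + 2) / η by positivity]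
  have hαη : 2 * (β + 1) + 2 ≤ α * η := by
    have : α * η = 5 * η + (2 * (β + 1) + 2) := by rw [hα]; field_simp
    linarith
  have hα0 : 0 < α := by linarith
  have hα4 : 0 < α - 4 := by linarith
  set θ := 1 / (α - 4) with hθ
  have hθ1 : θ * (α - 4) = 1 := by rw [hθ]; field_simp
  set μ := θ ^ 2 / 8 with hμ
  have hμ0 : 0 < μ := by rw [hμ]; positivity
  set N := μ / (100 * ((β + 1) ^ 2 + α ^ 2)) with hN
  have hN0 : 0 < N := by rw [hN]; positivity
  have hNμ : N * ((β + 1) ^ 2 + α ^ 2) ≤ μ / 100 := by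
    refine le_of_eq ?_
    rw [hN]; field_simp
  set m := 1 + 4 * C + 100 * C / μ with hm
  have hmC : 0 < 100 * C / μ := by positivity
  have hmμ : C / m ≤ μ / 100 := by
    have h1 : 100 * C ≤ m * μ := by
      rw [hm, add_mul, div_mul_cancel₀ _ hμ0.ne']
      linarith [show 0 < (1 + 4 * C) * μ by positivity]
    rw [div_le_div_iff₀ (by linarith) (by norm_num)]
    linarith
  set δ := min (10 * C) (1 / (480 * b ^ 2)) with hδ
  have hδ0 : 0 < δ := lt_min (by positivity) (by positivity)
  refine ⟨α, N, m, hα0, hN0, by linarith, 2 * ((50 + 2 * (α / δ)) * b ^ α) / (α * β),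
    by positivity, ?_⟩
  intro Ω f u hΩ hS hpde hu hpos hρ
  have hw := fun x hx => exp_logWeight_eq hS hu m α d hx (hpos x hx)
  have hpos' : ∀ x ∈ Ω, 0 < d + legVal f x := fun x hx => hu.eq_legVal hx ▸ hpos x hx
  have hρ' : ∀ x ∈ Ω, 1 / (rho f x * (d + legVal f x)) < b :=
    fun x hx => hu.eq_legVal hx ▸ hρ x hx
  have hD : ∀ x ∈ Ω, δ ≤ d + legVal f x := fun x hx => le_add_legVal hC hb hΩ hS hpos' hρ' hx
  have hd₁ : 0 ≤ 2 * ((50 + 2 * (α / δ)) * b ^ α) / (α * β) := by positivity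
  have hset : (fun x => Real.exp (-m / (C - f x)) * Phi f x /
      ((rho f x) ^ α * (d + u (gradv f x)) ^ α)) '' Ω =
      (fun x => Real.exp (logWeight C m α d f x) * Phi f x) '' Ω :=
    Set.image_congr fun x hx => by rw [hw x hx]; ring
  have hAval : Aval Ω C m α d f u =
      sSup ((fun x => Real.exp (logWeight C m α d f x) * Phi f x) '' Ω) := by
    rw [Aval, hset]
  by_cases hbdd : BddAbove ((fun x => Real.exp (logWeight C m α d f x) * Phi f x) '' Ω)
  swap
  · rw [hAval, Real.sSup_of_not_bddAbove hbdd]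
    exact le_max_of_le_left hd₁
  have hA : ∀ x ∈ Ω, Real.exp (logWeight C m α d f x) * Phi f x ≤ Aval Ω C m α d f u := by
    intro x hx
    rw [hAval]
    exact le_csSup hbdd (Set.mem_image_of_mem _ hx)
  rcases le_or_gt (Aval Ω C m α d f u) 0 with hA0 | hA0
  · exact le_max_of_le_left (hA0.trans hd₁)
  obtain ⟨R, hR⟩ := exists_weighted_gradient_le hΩ hS hpde hβ hη1 hη2 hα5 hαη hθ1 hμ hN0 hNμ hd
    hδ0 hD hρ' (by linarith) hmμ hA0 hA
  have hΦ0 : ∀ x ∈ Ω, 0 ≤ Phi f x ∧ 0 ≤ gradSq f f x := fun x hx => by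
    obtain ⟨v, w, ⟨J⟩⟩ := nonempty_pointJets hΩ hS hpde hx
    rw [J.Φ_eq, J.Ψ_eq]
    exact ⟨by positivity, by positivity⟩
  have hK : ∀ x ∈ Ω, 0 ≤ Kfun Ω C m α N d f u x ∧ Kfun Ω C m α N d f u x ≤ N := by
    intro x hx
    have h1 : Kfun Ω C m α N d f u x = N / Aval Ω C m α d f u *
        (Real.exp (logWeight C m α d f x) * Phi f x) := by
      rw [Kfun, hw x hx]; ring
    have h2 := hA x hx
    have h3 := (hΦ0 x hx).1
    rw [h1]
    refine ⟨by positivity, ?_⟩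
    rw [div_mul_eq_mul_div, div_le_iff₀ hA0]
    gcongr
  have hDint : ∀ x ∈ Ω, Real.exp (-m / (C - f x) + Kfun Ω C m α N d f u x) *
      (m / (C - f x) ^ 2) ^ 2 * gradSq f f x / ((rho f x) ^ α * (d + u (gradv f x)) ^ α) =
      Real.exp (Kfun Ω C m α N d f u x) *
        (Real.exp (logWeight C m α d f x) * (m / (C - f x) ^ 2) ^ 2 * gradSq f f x) := by
    intro x hx
    rw [hw x hx, Real.exp_add]; ring
  have hDv : ∀ x ∈ Ω, Real.exp (logWeight C m α d f x) * (m / (C - f x) ^ 2) ^ 2 *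
      gradSq f f x ≤ Dval Ω C m α N d f u := by
    intro x hx
    have h0 := (hΦ0 x hx).2
    have h1 : Real.exp (Kfun Ω C m α N d f u x) * (Real.exp (logWeight C m α d f x) *
        (m / (C - f x) ^ 2) ^ 2 * gradSq f f x) ≤ Dval Ω C m α N d f u := by
      rw [← hDint x hx]
      refine le_csSup ⟨Real.exp N * R, ?_⟩ (Set.mem_image_of_mem _ hx)
      rintro _ ⟨y, hy, rfl⟩
      have h2 := (hΦ0 y hy).2
      simp only
      rw [hDint y hy]
      gcongr
      · exact (hK y hy).2
      · exact hR y hy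
    exact (le_mul_of_one_le_left (by positivity) (Real.one_le_exp (hK x hx).1)).trans h1
  have hfin : α * β * Aval Ω C m α d f u ≤
      2 * Dval Ω C m α N d f u + (50 + 2 * (α / δ)) * b ^ α := by
    rw [← le_div_iff₀' (by positivity)]
    conv_lhs => rw [hAval]
    refine csSup_le (Set.Nonempty.image _ ⟨0, hΩ.zero_mem⟩) ?_
    rintro _ ⟨x, hx, rfl⟩
    rw [le_div_iff₀' (by positivity)]
    exact weighted_Phi_le hΩ hS hpde hβ hα0.le hδ0 hD hρ' (by linarith) (by linarith) hDv hx
  rw [le_max_iff]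
  by_contra! hlt
  obtain ⟨h1, h2⟩ := hlt
  rw [div_lt_iff₀ (by positivity)] at h1
  rw [div_mul_eq_mul_div, div_lt_iff₀ (by positivity)] at h2
  linarith
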